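/- arXiv:1911.05110 — 2 statements merged into one kernel-verified Lean document; each statement's English description precedes it below -/
import Mathlib

section
/- Let f : ℝ² → ℝ be smooth with f(0,0) = 0, f_x(0,0) = 0, f_y(0,0) = 0, and let Σ = {(x,y,z) ∈ ℝ³ : z ≤ f(x,y)}. For t > 0, let Σ̄_t = { p ∈ ℝ³ : (G_{t/2} * 1_Σ)(p) ≥ 1/2 }. Suppose z : (0,ε) → ℝ satisfies z(t) → 0 as t → 0⁺ and (√2 · G_{t/2} * 1_{Σ̄_t} − G_t * 1_Σ)(0,0,z(t)) = (√2 − 1)/2 for all t ∈ (0,ε). Then, as t → 0⁺, z(t) = t [f_xx + f_yy] + t² [ (1/2)(f_xxxx + 2 f_xxyy + f_yyyy) − (f_xx³ + 3 f_xx f_xy² + 3 f_yy f_xy² + f_yy³) ] + O(t³), where all derivatives of f are evaluated at (0,0); i.e., the natural two-kernel extrapolation scheme agrees with motion by mean curvature to second order. -/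
/-- Partial derivative in the first variable of a function of two real variables. -/
noncomputable def pdx (g : ℝ → ℝ → ℝ) (x y : ℝ) : ℝ := deriv (fun s => g s y) x

/-- Partial derivative in the second variable of a function of two real variables. -/
noncomputable def pdy (g : ℝ → ℝ → ℝ) (x y : ℝ) : ℝ := deriv (fun s => g x s) y

/-- The Gaussian kernel on `ℝ³` at time `t`. -/
noncomputable def G3 (t : ℝ) (p : ℝ × ℝ × ℝ) : ℝ :=
  (4 * Real.pi * t) ^ (-(3 : ℝ) / 2) * Real.exp (-(p.1 ^ 2 + p.2.1 ^ 2 + p.2.2 ^ 2) / (4 * t))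

/-- Convolution of the Gaussian kernel on `ℝ³` with a function. -/
noncomputable def conv3 (t : ℝ) (u : ℝ × ℝ × ℝ → ℝ) (p : ℝ × ℝ × ℝ) : ℝ :=
  ∫ q : ℝ × ℝ × ℝ, G3 t (p.1 - q.1, p.2.1 - q.2.1, p.2.2 - q.2.2) * u q

section
open MeasureTheory ProbabilityTheory Filter Topology

/-- The standard Gaussian on the line. -/
noncomputable def gmu : Measure ℝ := gaussianReal 0 1
/-- The standard Gaussian on the plane. -/
noncomputable def gga : Measure (ℝ × ℝ) := gmu.prod gmu

instance gmu_prob : IsProbabilityMeasure gmu := by unfold gmu; infer_instance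
instance gga_prob : IsProbabilityMeasure gga := by unfold gga; infer_instance

lemma gmu_int_pow (n : ℕ) : Integrable (fun x : ℝ => x ^ n) gmu := by
  have h := memLp_id_gaussianReal (μ := 0) (v := 1) (n : NNReal)
  have h2 := h.integrable_norm_pow'
  refine (integrable_norm_iff (by fun_prop)).1 ?_
  simpa [gmu] using h2

lemma gmu_int_abs_pow (n : ℕ) : Integrable (fun x : ℝ => (1 + |x|) ^ n) gmu := by
  have : (fun x : ℝ => (1 + |x|) ^ n)
      = fun x => ∑ m ∈ Finset.range (n + 1), |x| ^ (n - m) * (n.choose m : ℝ) := by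
    ext x
    rw [add_pow]; simp
  rw [this]
  refine integrable_finsetSum _ fun i _ => ?_
  have := (gmu_int_pow (n - i)).norm
  simp only [norm_pow, Real.norm_eq_abs] at this
  exact this.mul_const _

lemma gmu_density (g : ℝ → ℝ) :
    ∫ x, g x ∂gmu = ∫ x, gaussianPDFReal 0 1 x * g x := by
  unfold gmu
  rw [integral_gaussianReal_eq_integral_smul (by norm_num)]; simp

lemma gmu_integrable_density {g : ℝ → ℝ} (hg : Integrable g gmu) :
    Integrable (fun x => gaussianPDFReal 0 1 x * g x) := by
  unfold gmu at hg
  rw [gaussianReal_of_var_ne_zero _ (by norm_num)] at hg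
  rw [integrable_withDensity_iff_integrable_smul' (measurable_gaussianPDF 0 1)
    (by simp [gaussianPDF])] at hg
  simpa using hg

lemma pdf_eq (x : ℝ) : gaussianPDFReal 0 1 x = (√(2 * Real.pi))⁻¹ * Real.exp (- x ^ 2 / 2) := by
  simp [gaussianPDFReal]

lemma pdf_deriv (x : ℝ) : HasDerivAt (gaussianPDFReal 0 1) (- x * gaussianPDFReal 0 1 x) x := by
  have : gaussianPDFReal 0 1 = fun x => (√(2 * Real.pi))⁻¹ * Real.exp (- x ^ 2 / 2) := by
    ext x; exact pdf_eq x
  rw [this]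
  have h : HasDerivAt (fun x : ℝ => - x ^ 2 / 2) (-x) x := by
    have := ((hasDerivAt_pow 2 x).neg).div_const 2
    exact this.congr_deriv (by simp; ring)
  exact ((h.exp).const_mul ((√(2 * Real.pi))⁻¹)).congr_deriv (by ring)

lemma gmu_moment_succ (n : ℕ) :
    ∫ x, x ^ (n + 2) ∂gmu = (n + 1) * ∫ x, x ^ n ∂gmu := by
  rw [gmu_density, gmu_density, ← integral_const_mul]
  have h1 := gmu_integrable_density (gmu_int_pow (n + 2))
  have h2 := gmu_integrable_density (gmu_int_pow n)
  have h3 := gmu_integrable_density (gmu_int_pow (n + 1))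
  have h := integral_eq_zero_of_hasDerivAt_of_integrable
    (f := fun x => gaussianPDFReal 0 1 x * x ^ (n + 1))
    (f' := fun x => (n + 1) * (gaussianPDFReal 0 1 x * x ^ n)
        - gaussianPDFReal 0 1 x * x ^ (n + 2))
    (fun x => by
      refine ((pdf_deriv x).mul (hasDerivAt_pow (n + 1) x)).congr_deriv ?_
      push_cast
      ring_nf) ((h2.const_mul _).sub h1) h3
  rw [integral_sub (h2.const_mul _) h1] at h
  linarith

lemma gmu_m0 : ∫ x, x ^ 0 ∂gmu = 1 := by simp
lemma gmu_m1 : ∫ x, x ^ 1 ∂gmu = 0 := by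
  simp only [pow_one]; unfold gmu; simp
lemma gmu_m2 : ∫ x, x ^ 2 ∂gmu = 1 := by
  have := gmu_moment_succ 0; rw [gmu_m0] at this; simpa using this
lemma gmu_m3 : ∫ x, x ^ 3 ∂gmu = 0 := by
  have := gmu_moment_succ 1; rw [gmu_m1] at this; simpa using this
lemma gmu_m4 : ∫ x, x ^ 4 ∂gmu = 3 := by
  have := gmu_moment_succ 2; rw [gmu_m2] at this; norm_num at this; simpa using this
lemma gmu_m5 : ∫ x, x ^ 5 ∂gmu = 0 := by
  have := gmu_moment_succ 3; rw [gmu_m3] at this; simpa using this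
lemma gmu_m6 : ∫ x, x ^ 6 ∂gmu = 15 := by
  have := gmu_moment_succ 4; rw [gmu_m4] at this; norm_num at this; simpa using this

lemma poly6 (a0 a1 a2 a3 a4 a5 a6 : ℝ) :
    ∫ x, (a0 + a1 * x + a2 * x ^ 2 + a3 * x ^ 3 + a4 * x ^ 4 + a5 * x ^ 5 + a6 * x ^ 6) ∂gmu
      = a0 + a2 + 3 * a4 + 15 * a6 := by
  have e : (fun x : ℝ => a0 + a1 * x + a2 * x ^ 2 + a3 * x ^ 3 + a4 * x ^ 4 + a5 * x ^ 5
      + a6 * x ^ 6) = fun x => a0 * x ^ 0 + a1 * x ^ 1 + a2 * x ^ 2 + a3 * x ^ 3 + a4 * x ^ 4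
        + a5 * x ^ 5 + a6 * x ^ 6 := by ext x; simp
  rw [e]
  have i := fun (a : ℝ) n => (gmu_int_pow n).const_mul a
  rw [integral_add (by fun_prop (disch := exact i _ _)) (i _ _)]
  rw [integral_add (by fun_prop (disch := exact i _ _)) (i _ _)]
  rw [integral_add (by fun_prop (disch := exact i _ _)) (i _ _)]
  rw [integral_add (by fun_prop (disch := exact i _ _)) (i _ _)]
  rw [integral_add (by fun_prop (disch := exact i _ _)) (i _ _)]
  rw [integral_add (by fun_prop (disch := exact i _ _)) (i _ _)]
  simp only [integral_const_mul, gmu_m0, gmu_m1, gmu_m2, gmu_m3, gmu_m4, gmu_m5, gmu_m6]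
  ring

/-- The weight `1 + |x| + |y|`. -/
def ww (p : ℝ × ℝ) : ℝ := 1 + |p.1| + |p.2|

lemma ww_one (p : ℝ × ℝ) : 1 ≤ ww p := by unfold ww; have := abs_nonneg p.1; have := abs_nonneg p.2; linarith

lemma ww_cont : Continuous ww := by unfold ww; fun_prop

lemma ww_add (p r : ℝ × ℝ) : ww (p + r) ≤ ww p * ww r := by
  unfold ww
  have h1 := abs_add_le p.1 r.1
  have h2 := abs_add_le p.2 r.2
  have := abs_nonneg p.1; have := abs_nonneg p.2
  have := abs_nonneg r.1; have := abs_nonneg r.2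
  simp only [Prod.fst_add, Prod.snd_add]
  nlinarith [mul_nonneg (abs_nonneg p.1) (abs_nonneg r.1),
    mul_nonneg (abs_nonneg p.1) (abs_nonneg r.2), mul_nonneg (abs_nonneg p.2) (abs_nonneg r.1),
    mul_nonneg (abs_nonneg p.2) (abs_nonneg r.2)]

lemma gga_int_ww (k : ℕ) : Integrable (fun p => ww p ^ k) gga := by
  have h := (gmu_int_abs_pow k).mul_prod (gmu_int_abs_pow k)
  refine h.mono' (ww_cont.pow k).aestronglyMeasurable (Eventually.of_forall fun p => ?_)
  have h0 := ww_one p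
  rw [Real.norm_of_nonneg (by positivity), ← mul_pow]
  gcongr
  unfold ww
  nlinarith [mul_nonneg (abs_nonneg p.1) (abs_nonneg p.2)]

lemma gmu_neg : gmu.map (fun x => -x) = gmu := by
  unfold gmu; rw [gaussianReal_map_neg]; simp

lemma gga_neg : gga.map (fun x => -x) = gga := by
  unfold gga
  have := Measure.map_prod_map gmu gmu (f := fun x : ℝ => -x) (g := fun x : ℝ => -x)
    measurable_neg measurable_neg
  rw [gmu_neg] at this
  conv_rhs => rw [this]
  rfl

lemma gga2_neg : (gga.prod gga).map (fun x => -x) = gga.prod gga := by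
  have := Measure.map_prod_map gga gga (f := fun x : ℝ × ℝ => -x) (g := fun x : ℝ × ℝ => -x)
    measurable_neg measurable_neg
  rw [gga_neg] at this
  conv_rhs => rw [this]
  rfl

lemma odd_int {α : Type*} [MeasurableSpace α] [AddGroup α] [MeasurableNeg α] (ν : Measure α)
    (hν : ν.map (fun x => -x) = ν)
    (F : α → ℝ) (hF : ∀ x, F (-x) = - F x) : ∫ x, F x ∂ν = 0 := by
  have h : ∫ x, F x ∂ν = ∫ x, F (-x) ∂ν := by
    conv_lhs => rw [← hν]
    exact integral_map_equiv (MeasurableEquiv.neg α) F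
  simp only [hF, integral_neg] at h
  linarith

end

section
open MeasureTheory ProbabilityTheory Filter Topology

/-- The unnormalized error function. -/
noncomputable def EE (u : ℝ) : ℝ := ∫ s in (0 : ℝ)..u, Real.exp (- s ^ 2 / 2)

lemma EE_cont_integrand : Continuous (fun s : ℝ => Real.exp (- s ^ 2 / 2)) := by fun_prop

lemma EE_deriv (u : ℝ) : HasDerivAt EE (Real.exp (- u ^ 2 / 2)) u :=
  EE_cont_integrand.integral_hasStrictDerivAt 0 u |>.hasDerivAt

lemma EE_cont : Continuous EE :=
  continuous_iff_continuousAt.2 fun u => (EE_deriv u).continuousAt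

lemma EE_zero : EE 0 = 0 := by simp [EE]

lemma EE_strictMono : StrictMono EE :=
  strictMono_of_deriv_pos fun u => by rw [(EE_deriv u).deriv]; positivity

lemma EE_neg (u : ℝ) : EE (-u) = - EE u := by
  unfold EE
  have := intervalIntegral.integral_comp_neg (a := 0) (b := u)
    (fun s : ℝ => Real.exp (- s ^ 2 / 2))
  simp only [neg_sq, neg_zero] at this
  rw [intervalIntegral.integral_symm, ← this]

lemma EE_lip (u v : ℝ) : |EE u - EE v| ≤ |u - v| := by
  have := Convex.norm_image_sub_le_of_norm_hasDerivWithin_le (f := EE)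
    (f' := fun u => Real.exp (- u ^ 2 / 2)) (s := Set.univ) (C := 1) (x := v) (y := u)
    (fun x _ => (EE_deriv x).hasDerivWithinAt)
    (fun x _ => by
      rw [Real.norm_of_nonneg (by positivity)]
      exact Real.exp_le_one_iff.2 (by nlinarith [sq_nonneg x])) convex_univ trivial trivial
  simpa using this

lemma EE_gmu (u : ℝ) : gmu.real (Set.Iic u) = 1 / 2 + (√(2 * Real.pi))⁻¹ * EE u := by
  have hI : ∀ s : Set ℝ, gmu.real s = ∫ x in s, gaussianPDFReal 0 1 x := by
    intro s
    unfold gmu Measure.real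
    rw [gaussianReal_apply_eq_integral _ (by norm_num), ENNReal.toReal_ofReal]
    exact integral_nonneg fun x => gaussianPDFReal_nonneg _ _ _
  have hi := integrable_gaussianPDFReal 0 1
  have h0 : gmu.real (Set.Iic 0) = 1 / 2 := by
    have e1 : gmu.real (Set.Iic 0) = gmu.real (Set.Ici 0) := by
      conv_lhs => rw [← gmu_neg]
      unfold Measure.real
      rw [Measure.map_apply measurable_neg measurableSet_Iic]
      congr 2; ext x; simp
    have e2 : gmu.real (Set.Ici 0) = gmu.real (Set.Ioi 0) := by
      rw [hI, hI, integral_Ici_eq_integral_Ioi]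
    have e3 : gmu.real (Set.Iic 0) + gmu.real (Set.Ioi 0) = 1 := by
      have := measureReal_union (μ := gmu) (s₁ := Set.Iic (0:ℝ)) (s₂ := Set.Ioi 0)
        (Set.disjoint_left.2 fun x hx hy => absurd (Set.mem_Iic.1 hx) (not_le.2 (Set.mem_Ioi.1 hy))) measurableSet_Ioi
      rw [← this, Set.Iic_union_Ioi]; simp
    linarith
  have h1 : gmu.real (Set.Iic u) - gmu.real (Set.Iic 0)
      = ∫ x in (0:ℝ)..u, gaussianPDFReal 0 1 x := by
    rw [hI, hI]
    exact intervalIntegral.integral_Iic_sub_Iic hi.integrableOn hi.integrableOn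
  rw [h0] at h1
  have h2 : ∫ x in (0:ℝ)..u, gaussianPDFReal 0 1 x = (√(2 * Real.pi))⁻¹ * EE u := by
    unfold EE
    rw [← intervalIntegral.integral_const_mul]
    simp only [pdf_eq]
  linarith

lemma sqrt_two_pi_bds : 0 < √(2 * Real.pi) ∧ √(2 * Real.pi) ≤ 3 := by
  refine ⟨by positivity, ?_⟩
  rw [Real.sqrt_le_left (by norm_num)]
  have := Real.pi_lt_d2
  norm_num; linarith

lemma EE_bdd (u : ℝ) : |EE u| ≤ 3 / 2 := by
  obtain ⟨h1, h2⟩ := sqrt_two_pi_bds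
  have h3 := EE_gmu u
  have h4 : gmu.real (Set.Iic u) ≤ 1 := measureReal_le_one
  have h5 : 0 ≤ gmu.real (Set.Iic u) := measureReal_nonneg
  have h6 : |(√(2 * Real.pi))⁻¹ * EE u| ≤ 1 / 2 := by rw [abs_le]; constructor <;> linarith
  rw [abs_mul, abs_of_pos (inv_pos.2 h1), inv_mul_le_iff₀ h1] at h6
  linarith

lemma EE_diff (u v : ℝ) : |EE u - EE v| ≤ 3 * min |u - v| 1 := by
  rcases le_total |u - v| 1 with h | h
  · rw [min_eq_left h]; linarith [EE_lip u v, abs_nonneg (u - v)]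
  · rw [min_eq_right h]
    have := abs_sub (EE u) (EE v)
    linarith [EE_bdd u, EE_bdd v]

lemma EE_lower_pos (u h : ℝ) (hu : |u| ≤ 1) (hh : 0 ≤ h) (h1 : h ≤ 1) :
    Real.exp (-2) * h ≤ EE (u + h) - EE u := by
  have := Convex.mul_sub_le_image_sub_of_le_deriv (D := Set.Icc u (u + h)) (convex_Icc _ _)
    (f := EE) EE_cont.continuousOn
    (fun x _ => (EE_deriv x).differentiableAt.differentiableWithinAt) (C := Real.exp (-2))
    (fun x hx => by
      rw [interior_Icc] at hx
      rw [(EE_deriv x).deriv]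
      apply Real.exp_le_exp.2
      have := abs_le.1 hu
      nlinarith [hx.1, hx.2]) u (by simp [hh]) (u + h) (by simp [hh]) (by linarith)
  linarith

lemma EE_lower_pos' (u v : ℝ) (hu : |u| ≤ 1) (hh : u ≤ v) :
    Real.exp (-2) * min |u - v| 1 ≤ EE v - EE u := by
  have e : |u - v| = v - u := by rw [abs_sub_comm, abs_of_nonneg (by linarith)]
  have := EE_lower_pos u (min (v - u) 1) hu (le_min (by linarith) (by norm_num)) (min_le_right _ _)
  rw [e]
  refine this.trans ?_
  have : EE (u + min (v - u) 1) ≤ EE v :=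
    EE_strictMono.monotone (by have := min_le_left (v - u) 1; linarith)
  linarith

lemma EE_lower_neg' (u v : ℝ) (hu : |u| ≤ 1) (hh : v ≤ u) :
    Real.exp (-2) * min |u - v| 1 ≤ EE u - EE v := by
  have := EE_lower_pos' (-u) (-v) (by rwa [abs_neg]) (by linarith)
  rw [EE_neg, EE_neg] at this
  have e : |-u - -v| = |u - v| := by rw [← abs_neg]; congr 1; ring
  rw [e] at this
  linarith

lemma exp_est (x : ℝ) (hx : 0 ≤ x) : |Real.exp (-x) - 1 + x| ≤ x ^ 2 := by
  have h1 : 1 - x ≤ Real.exp (-x) := Real.one_sub_le_exp_neg x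
  have h2 : Real.exp (-x) ≤ 1 - x + x ^ 2 := by
    rcases le_total x 1 with h | h
    · have := Real.abs_exp_sub_one_sub_id_le (x := -x) (by rw [abs_neg, abs_of_nonneg hx]; exact h)
      have := (abs_le.1 this).2
      nlinarith
    · have : Real.exp (-x) ≤ 1 := Real.exp_le_one_iff.2 (by linarith)
      nlinarith
  rw [abs_le]; constructor <;> nlinarith

lemma EE_taylor (u : ℝ) : |EE u - u + u ^ 3 / 6| ≤ |u| ^ 5 := by
  have hd : ∀ x, HasDerivAt (fun u => EE u - u + u ^ 3 / 6)
      (Real.exp (-x ^ 2 / 2) - 1 + x ^ 2 / 2) x := by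
    intro x
    refine (((EE_deriv x).sub (hasDerivAt_id x)).add ((hasDerivAt_pow 3 x).div_const 6)).congr_deriv
      ?_
    ring_nf
  have := Convex.norm_image_sub_le_of_norm_hasDerivWithin_le (f := fun u => EE u - u + u ^ 3 / 6)
    (f' := fun x => Real.exp (-x ^ 2 / 2) - 1 + x ^ 2 / 2) (s := Set.Icc (-|u|) |u|)
    (C := |u| ^ 4) (x := 0) (y := u)
    (fun x _ => (hd x).hasDerivWithinAt)
    (fun x hx => by
      have h := exp_est (x ^ 2 / 2) (by positivity)
      have e : -x ^ 2 / 2 = -(x ^ 2 / 2) := by ring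
      rw [Real.norm_eq_abs, e]
      refine h.trans ?_
      have h3 : |x| ≤ |u| := abs_le.2 hx
      have h4 : x ^ 2 ≤ |u| ^ 2 := by rw [← sq_abs x]; gcongr
      have h5 : 0 ≤ x ^ 2 := by positivity
      have : (x ^ 2) ^ 2 ≤ (|u| ^ 2) ^ 2 := by gcongr
      nlinarith) (convex_Icc _ _) (by simp) (by simp [neg_abs_le, le_abs_self])
  simp only [EE_zero, Real.norm_eq_abs] at this
  calc _ = |EE u - u + u ^ 3 / 6 - (0 - 0 + 0 ^ 3 / 6)| := by congr 1; ring
    _ ≤ |u| ^ 4 * |u - 0| := this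
    _ = _ := by rw [sub_zero]; ring

/-- Pointwise expansion. -/
lemma EE_expand (τ g T ζ : ℝ) (hτ : 0 ≤ τ) :
    |EE (τ * (g - ζ)) - (τ * (T - ζ) - τ ^ 3 / 6 * (T - ζ) ^ 3)|
      ≤ 3 * min (τ * |g - T|) 1 + τ ^ 5 * |T - ζ| ^ 5 := by
  have h1 := EE_diff (τ * (g - ζ)) (τ * (T - ζ))
  have e : |τ * (g - ζ) - τ * (T - ζ)| = τ * |g - T| := by
    rw [← mul_sub, abs_mul, abs_of_nonneg hτ]; congr 2; ring
  rw [e] at h1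
  have h2 := EE_taylor (τ * (T - ζ))
  rw [abs_mul, abs_of_nonneg hτ, mul_pow τ |T - ζ|] at h2
  calc _ = |(EE (τ * (g - ζ)) - EE (τ * (T - ζ))) + (EE (τ * (T - ζ)) - τ * (T - ζ)
        + (τ * (T - ζ)) ^ 3 / 6)| := by congr 1; ring
    _ ≤ _ := (abs_add_le _ _).trans (add_le_add h1 h2)

end

section
open MeasureTheory ProbabilityTheory Filter Topology

/-- One dimensional Gaussian kernel. -/
noncomputable def kk (σ p q : ℝ) : ℝ := (√(2 * Real.pi) * σ)⁻¹ * Real.exp (-(p - q) ^ 2 / (2 * σ ^ 2))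

lemma kk_pdf (σ p x : ℝ) (hσ : 0 < σ) : σ * kk σ p (p + σ * x) = gaussianPDFReal 0 1 x := by
  rw [pdf_eq]
  unfold kk
  have : -(p - (p + σ * x)) ^ 2 / (2 * σ ^ 2) = -x ^ 2 / 2 := by field_simp; ring
  rw [this, mul_inv]
  field_simp

lemma int_affine (σ p : ℝ) (hσ : 0 < σ) (F : ℝ → ℝ) :
    ∫ q, F q = ∫ x, σ * F (p + σ * x) := by
  rw [integral_const_mul]
  have h := Measure.integral_comp_mul_left (fun x => F (p + x)) σ
  rw [h, integral_add_left_eq_self, abs_of_pos (inv_pos.2 hσ), smul_eq_mul]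
  field_simp

lemma kk_int (σ p : ℝ) (hσ : 0 < σ) (g : ℝ → ℝ) :
    ∫ q, kk σ p q * g q = ∫ x, g (p + σ * x) ∂gmu := by
  rw [gmu_density, int_affine σ p hσ]
  congr 1; ext x
  rw [← mul_assoc, kk_pdf σ p x hσ]

lemma kk_cont (σ p : ℝ) : Continuous (kk σ p) := by unfold kk; fun_prop

lemma kk_integrable (σ p : ℝ) (hσ : 0 < σ) : Integrable (kk σ p) := by
  have h := integrable_gaussianPDFReal 0 1
  have h2 : Integrable (fun x => σ⁻¹ * gaussianPDFReal 0 1 x) := h.const_mul _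
  have e : (fun x => σ⁻¹ * gaussianPDFReal 0 1 x) = fun x => kk σ p (p + σ * x) := by
    ext x; rw [← kk_pdf σ p x hσ]; field_simp
  rw [e] at h2
  have h3 := (integrable_comp_mul_left_iff (fun x => kk σ p (p + x)) hσ.ne').1 h2
  have h4 := h3.comp_sub_right p
  simpa using h4

lemma kk_nonneg (σ p q : ℝ) (hσ : 0 < σ) : 0 ≤ kk σ p q := by unfold kk; positivity

lemma G3_kk (s : ℝ) (hs : 0 < s) (p q : ℝ × ℝ × ℝ) :
    G3 s (p.1 - q.1, p.2.1 - q.2.1, p.2.2 - q.2.2)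
      = kk √(2 * s) p.1 q.1 * (kk √(2 * s) p.2.1 q.2.1 * kk √(2 * s) p.2.2 q.2.2) := by
  unfold G3 kk
  have h1 : √(2 * Real.pi) * √(2 * s) = √(4 * Real.pi * s) := by
    rw [← Real.sqrt_mul (by positivity)]; congr 1; ring
  have h2 : √(2 * s) ^ 2 = 2 * s := Real.sq_sqrt (by positivity)
  have h3 : (4 * Real.pi * s) ^ (-(3 : ℝ) / 2) = (√(4 * Real.pi * s))⁻¹ ^ 3 := by
    rw [Real.sqrt_eq_rpow, ← Real.rpow_neg (by positivity), ← Real.rpow_natCast,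
      ← Real.rpow_mul (by positivity)]
    norm_num
  rw [h1, h2, h3]
  have h4 : -((p.1 - q.1) ^ 2 + (p.2.1 - q.2.1) ^ 2 + (p.2.2 - q.2.2) ^ 2) / (4 * s)
    = -(p.1 - q.1) ^ 2 / (2 * (2 * s)) + (-(p.2.1 - q.2.1) ^ 2 / (2 * (2 * s))
      + -(p.2.2 - q.2.2) ^ 2 / (2 * (2 * s))) := by field_simp; ring
  simp only
  rw [h4, Real.exp_add, Real.exp_add]; ring

lemma EE_comp_int {α : Type*} [MeasurableSpace α] (ν : Measure α) [IsFiniteMeasure ν] (φ : α → ℝ)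
    (hφ : Measurable φ) : Integrable (fun a => EE (φ a)) ν :=
  Integrable.of_bound (EE_cont.measurable.comp hφ).aestronglyMeasurable (3 / 2)
    (Eventually.of_forall fun _ => EE_bdd _)

lemma conv3_subgraph (φ : ℝ → ℝ → ℝ) (hφ : Measurable (fun p : ℝ × ℝ => φ p.1 p.2))
    (s : ℝ) (hs : 0 < s) (p1 p2 p3 : ℝ) :
    conv3 s (Set.indicator {p : ℝ × ℝ × ℝ | p.2.2 ≤ φ p.1 p.2.1} 1) (p1, p2, p3)
      = 1 / 2 + (√(2 * Real.pi))⁻¹ * ∫ ξ, EE ((φ (p1 + √(2 * s) * ξ.1) (p2 + √(2 * s) * ξ.2) - p3)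
        / √(2 * s)) ∂gga := by
  have hσ : 0 < √(2 * s) := by positivity
  unfold conv3
  simp only [fun q : ℝ × ℝ × ℝ => G3_kk s hs (p1, p2, p3) q]
  generalize √(2 * s) = σ at hσ
  have hm3 : Measurable (fun q : ℝ × ℝ × ℝ => φ q.1 q.2.1) :=
    hφ.comp (measurable_fst.prodMk (measurable_fst.comp measurable_snd))
  have hS : MeasurableSet {p : ℝ × ℝ × ℝ | p.2.2 ≤ φ p.1 p.2.1} :=
    measurableSet_le (by fun_prop) hm3
  set ind : ℝ × ℝ × ℝ → ℝ := Set.indicator {p : ℝ × ℝ × ℝ | p.2.2 ≤ φ p.1 p.2.1} 1 with hind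
  have hindm : Measurable ind := measurable_one.indicator hS
  have hindb : ∀ q, ‖ind q‖ ≤ 1 := by
    intro q; rw [hind, Set.indicator_apply]; split_ifs <;> simp
  have I3 : Integrable (fun q : ℝ × ℝ × ℝ => kk σ p1 q.1 * (kk σ p2 q.2.1 * kk σ p3 q.2.2) * ind q)
      (volume.prod (volume.prod volume)) := by
    have h := (kk_integrable σ p1 hσ).mul_prod
      ((kk_integrable σ p2 hσ).mul_prod (kk_integrable σ p3 hσ))
    exact h.mul_bdd hindm.aestronglyMeasurable (Eventually.of_forall hindb)
  have I2 : ∀ x, Integrable (fun q : ℝ × ℝ => kk σ p1 x * (kk σ p2 q.1 * kk σ p3 q.2) * ind (x, q))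
      (volume.prod volume) := by
    intro x
    have h := ((kk_integrable σ p2 hσ).mul_prod (kk_integrable σ p3 hσ)).const_mul (kk σ p1 x)
    exact h.mul_bdd (hindm.comp measurable_prodMk_left).aestronglyMeasurable
      (Eventually.of_forall fun q => hindb _)
  have e1 : ∫ q : ℝ × ℝ × ℝ, kk σ p1 q.1 * (kk σ p2 q.2.1 * kk σ p3 q.2.2) * ind q
      = ∫ x, ∫ y, ∫ z, kk σ p1 x * (kk σ p2 y * kk σ p3 z) * ind (x, y, z) := by
    have := integral_prod _ I3
    refine Eq.trans this ?_
    congr 1; ext x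
    exact integral_prod _ (I2 x)
  have e2 : ∀ x y, ∫ z, kk σ p1 x * (kk σ p2 y * kk σ p3 z) * ind (x, y, z)
      = kk σ p1 x * (kk σ p2 y * (1 / 2 + (√(2 * Real.pi))⁻¹ * EE ((φ x y - p3) / σ))) := by
    intro x y
    have : ∀ z, kk σ p1 x * (kk σ p2 y * kk σ p3 z) * ind (x, y, z)
      = kk σ p1 x * (kk σ p2 y * (kk σ p3 z * ind (x, y, z))) := by intro z; ring
    simp only [this, integral_const_mul]
    rw [kk_int σ p3 hσ, ← EE_gmu, ← integral_indicator_one measurableSet_Iic]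
    congr 3
    ext z
    rw [hind]
    simp only [Set.indicator_apply, Set.mem_ofPred_eq, Set.mem_Iic, le_div_iff₀ hσ]
    have : p3 + σ * z ≤ φ x y ↔ z * σ ≤ φ x y - p3 := by
      constructor <;> intro h <;> linarith
    simp [this]
  rw [e1]
  simp only [e2, integral_const_mul, kk_int σ p2 hσ, kk_int σ p1 hσ]
  have hm2 : Measurable (fun ξ : ℝ × ℝ => (φ (p1 + σ * ξ.1) (p2 + σ * ξ.2) - p3) / σ) := by
    have : Measurable (fun ξ : ℝ × ℝ => φ (p1 + σ * ξ.1) (p2 + σ * ξ.2)) :=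
      hφ.comp ((measurable_const.add (measurable_fst.const_mul σ)).prodMk
        (measurable_const.add (measurable_snd.const_mul σ)))
    exact (this.sub_const _).div_const _
  have Ig := EE_comp_int gga _ hm2
  have : ∫ ξ, (1 / 2 + (√(2 * Real.pi))⁻¹ * EE ((φ (p1 + σ * ξ.1) (p2 + σ * ξ.2) - p3) / σ)) ∂gga
      = 1 / 2 + (√(2 * Real.pi))⁻¹ * ∫ ξ, EE ((φ (p1 + σ * ξ.1) (p2 + σ * ξ.2) - p3) / σ) ∂gga := by
    rw [integral_add (integrable_const _) (Ig.const_mul _), integral_const_mul]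
    simp
  rw [← this]
  unfold gga at Ig ⊢
  exact (integral_prod _ ((integrable_const _).add (Ig.const_mul _))).symm

end

section
open MeasureTheory ProbabilityTheory Filter Topology

lemma EE_tendsto_top : Tendsto EE atTop (𝓝 (√(2 * Real.pi) / 2)) := by
  have h := tendsto_cdf_atTop gmu
  have h2 : ∀ u, EE u = √(2 * Real.pi) * (cdf gmu u - 1 / 2) := by
    intro u
    rw [cdf_eq_real, EE_gmu]
    have := sqrt_two_pi_bds.1
    field_simp; ring
  have h3 : EE = fun u => √(2 * Real.pi) * (cdf gmu u - 1 / 2) := funext h2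
  rw [h3]
  have := (h.sub_const (1 / 2)).const_mul √(2 * Real.pi)
  convert this using 2; ring

lemma EE_tendsto_bot : Tendsto EE atBot (𝓝 (-(√(2 * Real.pi) / 2))) := by
  have := (EE_tendsto_top.comp tendsto_neg_atBot_atTop).neg
  refine this.congr fun u => ?_
  simp [EE_neg]

lemma root_exists {α : Type*} [MeasurableSpace α] (ν : Measure α) [IsProbabilityMeasure ν]
    (φ : α → ℝ) (hφ : Measurable φ) (τ : ℝ) (hτ : 0 < τ) :
    ∃ r : ℝ, ∫ a, EE ((φ a - r) / τ) ∂ν = 0 ∧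
      ∀ z, 0 ≤ ∫ a, EE ((φ a - z) / τ) ∂ν ↔ z ≤ r := by
  set J : ℝ → ℝ := fun z => ∫ a, EE ((φ a - z) / τ) ∂ν with hJ
  have hIz : ∀ z, Integrable (fun a => EE ((φ a - z) / τ)) ν := fun z =>
    EE_comp_int ν _ ((hφ.sub_const z).div_const τ)
  have hanti : StrictAnti J := by
    intro z z' hzz
    have hp : 0 < ∫ a, (EE ((φ a - z) / τ) - EE ((φ a - z') / τ)) ∂ν := by
      have hlt : ∀ a, 0 < EE ((φ a - z) / τ) - EE ((φ a - z') / τ) := fun a =>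
        sub_pos.2 (EE_strictMono (by gcongr))
      rw [integral_pos_iff_support_of_nonneg (fun a => (hlt a).le) ((hIz z).sub (hIz z'))]
      have : (Function.support fun a => EE ((φ a - z) / τ) - EE ((φ a - z') / τ)) = Set.univ := by
        ext a; simp [(hlt a).ne']
      rw [this]; simp
    rw [integral_sub (hIz _) (hIz _)] at hp
    exact sub_pos.1 hp
  have hcont : Continuous J := by
    refine continuous_of_dominated (bound := fun _ => 3 / 2) (fun z => (hIz z).aestronglyMeasurable)
      (fun z => Eventually.of_forall fun a => EE_bdd _) (integrable_const _)
      (Eventually.of_forall fun a => EE_cont.comp (by fun_prop))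
  have hpos : 0 < √(2 * Real.pi) / 2 := half_pos sqrt_two_pi_bds.1
  have htop : Tendsto J atTop (𝓝 (-(√(2 * Real.pi) / 2))) := by
    have : ∫ a, (-(√(2 * Real.pi) / 2)) ∂ν = -(√(2 * Real.pi) / 2) := by simp
    rw [← this]
    refine tendsto_integral_filter_of_dominated_convergence (fun _ => 3 / 2)
      (Eventually.of_forall fun z => (hIz z).aestronglyMeasurable)
      (Eventually.of_forall fun z => Eventually.of_forall fun a => EE_bdd _) (integrable_const _)
      (Eventually.of_forall fun a => EE_tendsto_bot.comp ?_)
    refine Tendsto.atBot_div_const hτ ?_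
    exact tendsto_atBot_add_const_left _ (φ a) tendsto_neg_atTop_atBot
  have hbot : Tendsto J atBot (𝓝 (√(2 * Real.pi) / 2)) := by
    have : ∫ a, (√(2 * Real.pi) / 2) ∂ν = √(2 * Real.pi) / 2 := by simp
    rw [← this]
    refine tendsto_integral_filter_of_dominated_convergence (fun _ => 3 / 2)
      (Eventually.of_forall fun z => (hIz z).aestronglyMeasurable)
      (Eventually.of_forall fun z => Eventually.of_forall fun a => EE_bdd _) (integrable_const _)
      (Eventually.of_forall fun a => EE_tendsto_top.comp ?_)
    refine Tendsto.atTop_div_const hτ ?_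
    exact tendsto_atTop_add_const_left _ (φ a) tendsto_neg_atBot_atTop
  obtain ⟨b, hb⟩ := (htop.eventually (gt_mem_nhds (neg_lt_zero.2 hpos))).exists
  obtain ⟨a, ha⟩ := (hbot.eventually (lt_mem_nhds hpos)).exists
  obtain ⟨r, hr⟩ := mem_range_of_exists_le_of_exists_ge hcont ⟨b, hb.le⟩ ⟨a, ha.le⟩
  refine ⟨r, hr, fun z => ?_⟩
  change 0 ≤ J z ↔ _
  rw [← hr]
  exact hanti.le_iff_ge

lemma sbar_exists (φ : ℝ → ℝ → ℝ) (hφ : Measurable (fun p : ℝ × ℝ => φ p.1 p.2)) (τ : ℝ)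
    (hτ : 0 < τ) : ∃ fb : ℝ → ℝ → ℝ, Measurable (fun p : ℝ × ℝ => fb p.1 p.2) ∧
      (∀ x y, ∫ ξ, EE ((φ (x + τ * ξ.1) (y + τ * ξ.2) - fb x y) / τ) ∂gga = 0) ∧
      ∀ x y z, 0 ≤ ∫ ξ, EE ((φ (x + τ * ξ.1) (y + τ * ξ.2) - z) / τ) ∂gga ↔ z ≤ fb x y := by
  have hm : ∀ x y, Measurable (fun ξ : ℝ × ℝ => φ (x + τ * ξ.1) (y + τ * ξ.2)) := fun x y =>
    hφ.comp ((measurable_const.add (measurable_fst.const_mul τ)).prodMk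
        (measurable_const.add (measurable_snd.const_mul τ)))
  choose fb h1 h2 using fun x y => root_exists gga _ (hm x y) τ hτ
  refine ⟨fb, ?_, h1, h2⟩
  refine measurable_of_Ici fun z => ?_
  have : (fun p : ℝ × ℝ => fb p.1 p.2) ⁻¹' Set.Ici z = {p : ℝ × ℝ | 0 ≤
      ∫ ξ, EE ((φ (p.1 + τ * ξ.1) (p.2 + τ * ξ.2) - z) / τ) ∂gga} := by
    ext p; simp [h2]
  rw [this]
  refine measurableSet_le measurable_const ?_
  refine StronglyMeasurable.measurable ?_
  refine StronglyMeasurable.integral_prod_right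
    (f := fun (p : ℝ × ℝ) (ξ : ℝ × ℝ) => EE ((φ (p.1 + τ * ξ.1) (p.2 + τ * ξ.2) - z) / τ)) ?_
  refine Measurable.stronglyMeasurable (EE_cont.measurable.comp ?_)
  refine Measurable.div_const (Measurable.sub_const (hφ.comp (g := fun p : ℝ × ℝ => φ p.1 p.2)
    (f := fun q : (ℝ × ℝ) × (ℝ × ℝ) => (q.1.1 + τ * q.2.1, q.1.2 + τ * q.2.2)) ?_) z) τ
  fun_prop

/-- Reformulation of the hypothesis of the theorem. -/
lemma reform (f : ℝ → ℝ → ℝ) (hf : Measurable (fun p : ℝ × ℝ => f p.1 p.2))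
    (S : Set (ℝ × ℝ × ℝ)) (hS : S = {p : ℝ × ℝ × ℝ | p.2.2 ≤ f p.1 p.2.1})
    (Sb : Set (ℝ × ℝ × ℝ)) (t : ℝ) (ht : 0 < t)
    (hSb : Sb = {p : ℝ × ℝ × ℝ | 1 / 2 ≤ conv3 (t / 2) (Set.indicator S 1) p})
    (z τ : ℝ) (hτ : 0 < τ) (hτt : τ ^ 2 = t)
    (hzeq : Real.sqrt 2 * conv3 (t / 2) (Set.indicator Sb 1) (0, 0, z)
        - conv3 t (Set.indicator S 1) (0, 0, z) = (Real.sqrt 2 - 1) / 2) :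
    ∃ fb : ℝ → ℝ → ℝ, Measurable (fun p : ℝ × ℝ => fb p.1 p.2) ∧
      (∀ x y, ∫ ξ, EE ((f (x + τ * ξ.1) (y + τ * ξ.2) - fb x y) / τ) ∂gga = 0) ∧
      √2 * ∫ ξ, EE ((fb (τ * ξ.1) (τ * ξ.2) - z) / τ) ∂gga
        = ∫ ξ, EE ((f (√2 * τ * ξ.1) (√2 * τ * ξ.2) - z) / (√2 * τ)) ∂gga := by
  obtain ⟨fb, h1, h2, h3⟩ := sbar_exists f hf τ hτ
  refine ⟨fb, h1, h2, ?_⟩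
  have e1 : √(2 * (t / 2)) = τ := by
    rw [← hτt, show 2 * (τ ^ 2 / 2) = τ ^ 2 by ring, Real.sqrt_sq hτ.le]
  have e2 : √(2 * t) = √2 * τ := by
    rw [← hτt, Real.sqrt_mul (by norm_num), Real.sqrt_sq hτ.le]
  have hpi := sqrt_two_pi_bds.1
  have hSb' : Sb = {p : ℝ × ℝ × ℝ | p.2.2 ≤ fb p.1 p.2.1} := by
    rw [hSb]
    ext ⟨x, y, w⟩
    simp only [Set.mem_ofPred_eq]
    rw [hS, conv3_subgraph f hf _ (by positivity), e1, ← h3 x y w]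
    rw [le_add_iff_nonneg_right, mul_nonneg_iff_of_pos_left (by positivity)]
  rw [hSb', hS, conv3_subgraph fb h1 _ (by positivity), conv3_subgraph f hf _ ht, e1, e2] at hzeq
  simp only [zero_add] at hzeq
  have : (√(2 * Real.pi))⁻¹ * (√2 * ∫ ξ, EE ((fb (τ * ξ.1) (τ * ξ.2) - z) / τ) ∂gga)
      = (√(2 * Real.pi))⁻¹ *
        ∫ ξ, EE ((f (√2 * τ * ξ.1) (√2 * τ * ξ.2) - z) / (√2 * τ)) ∂gga := by linarith
  exact mul_left_cancel₀ (inv_ne_zero hpi.ne') this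

end

section
open MeasureTheory ProbabilityTheory Filter Topology

/-- Smoothness of a function of two variables. -/
def Sm (g : ℝ → ℝ → ℝ) : Prop := ContDiff ℝ (⊤ : ℕ∞) (fun p : ℝ × ℝ => g p.1 p.2)

lemma Sm.diff {g : ℝ → ℝ → ℝ} (hg : Sm g) : Differentiable ℝ (fun p : ℝ × ℝ => g p.1 p.2) :=
  ContDiff.differentiable hg (by simp)

lemma pdx_eq {g : ℝ → ℝ → ℝ} (hg : Sm g) (a b : ℝ) :
    pdx g a b = fderiv ℝ (fun p : ℝ × ℝ => g p.1 p.2) (a, b) (1, 0) := by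
  have h := (hg.diff (a, b)).hasFDerivAt
  have h2 : HasDerivAt (fun s : ℝ => (s, b)) ((1 : ℝ), (0 : ℝ)) a :=
    (hasDerivAt_id a).prodMk (hasDerivAt_const a b)
  exact (h.comp_hasDerivAt a h2).deriv

lemma pdy_eq {g : ℝ → ℝ → ℝ} (hg : Sm g) (a b : ℝ) :
    pdy g a b = fderiv ℝ (fun p : ℝ × ℝ => g p.1 p.2) (a, b) (0, 1) := by
  have h := (hg.diff (a, b)).hasFDerivAt
  have h2 : HasDerivAt (fun s : ℝ => (a, s)) ((0 : ℝ), (1 : ℝ)) b :=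
    (hasDerivAt_const b a).prodMk (hasDerivAt_id b)
  exact (h.comp_hasDerivAt b h2).deriv

lemma Sm.fd {g : ℝ → ℝ → ℝ} (hg : Sm g) :
    ContDiff ℝ (⊤ : ℕ∞) (fderiv ℝ (fun p : ℝ × ℝ => g p.1 p.2)) :=
  ContDiff.fderiv_right hg (by simp)

lemma Sm.x {g : ℝ → ℝ → ℝ} (hg : Sm g) : Sm (pdx g) := by
  unfold Sm
  simp only [pdx_eq hg, Prod.mk.eta]
  exact hg.fd.clm_apply contDiff_const

lemma Sm.y {g : ℝ → ℝ → ℝ} (hg : Sm g) : Sm (pdy g) := by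
  unfold Sm
  simp only [pdy_eq hg, Prod.mk.eta]
  exact hg.fd.clm_apply contDiff_const

lemma pd_comm {g : ℝ → ℝ → ℝ} (hg : Sm g) : pdy (pdx g) = pdx (pdy g) := by
  ext a b
  rw [pdy_eq hg.x, pdx_eq hg.y]
  simp only [pdx_eq hg, pdy_eq hg, Prod.mk.eta]
  have hd : DifferentiableAt ℝ (fderiv ℝ (fun p : ℝ × ℝ => g p.1 p.2)) (a, b) :=
    (hg.fd.differentiable (by simp)) _
  have hs : IsSymmSndFDerivAt ℝ (fun p : ℝ × ℝ => g p.1 p.2) (a, b) :=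
    (ContDiff.contDiffAt hg).isSymmSndFDerivAt (by
      simp only [minSmoothness_of_isRCLikeNormedField]
      exact WithTop.coe_le_coe.2 (le_top : (2 : ℕ∞) ≤ ⊤))
  rw [fderiv_clm_apply hd (by fun_prop), fderiv_clm_apply hd (by fun_prop)]
  simpa using hs.eq (0, 1) (1, 0)

lemma chain2 {g : ℝ → ℝ → ℝ} (hg : Sm g) (x y s : ℝ) :
    HasDerivAt (fun s => g (s * x) (s * y))
      (x * pdx g (s * x) (s * y) + y * pdy g (s * x) (s * y)) s := by
  have h := (hg.diff (s * x, s * y)).hasFDerivAt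
  have h2 : HasDerivAt (fun s : ℝ => (s * x, s * y)) (x, y) s :=
    (hasDerivAt_mul_const x).prodMk (hasDerivAt_mul_const y)
  have h3 := h.comp_hasDerivAt s h2
  refine h3.congr_deriv ?_
  rw [pdx_eq hg, pdy_eq hg]
  have : (x, y) = x • ((1 : ℝ), (0 : ℝ)) + y • ((0 : ℝ), (1 : ℝ)) := by ext <;> simp
  conv_lhs => rw [this]
  rw [map_add, map_smul, map_smul]; simp

/-- Mixed partial derivatives. -/
noncomputable def mm (f : ℝ → ℝ → ℝ) (i j : ℕ) : ℝ → ℝ → ℝ := pdx^[i] (pdy^[j] f)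

lemma mm_sm {f : ℝ → ℝ → ℝ} (hf : Sm f) (i j : ℕ) : Sm (mm f i j) := by
  unfold mm
  induction i with
  | zero =>
    induction j with
    | zero => exact hf
    | succ j ih => simp only [Function.iterate_zero, id] at ih ⊢
                   rw [Function.iterate_succ_apply']; exact ih.y
  | succ i ih => rw [Function.iterate_succ_apply']; exact ih.x

lemma mm_x {f : ℝ → ℝ → ℝ} (i j : ℕ) : pdx (mm f i j) = mm f (i + 1) j := by
  unfold mm; rw [Function.iterate_succ_apply']

lemma mm_y {f : ℝ → ℝ → ℝ} (hf : Sm f) (i j : ℕ) : pdy (mm f i j) = mm f i (j + 1) := by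
  induction i with
  | zero => simp only [mm, Function.iterate_zero, id]; rw [Function.iterate_succ_apply']
  | succ i ih => rw [← mm_x, pd_comm (mm_sm hf i j), ih, mm_x]

lemma mm_der {f : ℝ → ℝ → ℝ} (hf : Sm f) (i j : ℕ) (x y s : ℝ) :
    HasDerivAt (fun s => mm f i j (s * x) (s * y))
      (x * mm f (i + 1) j (s * x) (s * y) + y * mm f i (j + 1) (s * x) (s * y)) s := by
  have := chain2 (mm_sm hf i j) x y s
  rwa [mm_x, mm_y hf] at this

/-- Directional derivatives. -/
noncomputable def hh (f : ℝ → ℝ → ℝ) (x y : ℝ) (k : ℕ) (s : ℝ) : ℝ :=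
  ∑ i ∈ Finset.range (k + 1),
    (k.choose i : ℝ) * (x ^ i * y ^ (k - i)) * mm f i (k - i) (s * x) (s * y)

lemma hh_der {f : ℝ → ℝ → ℝ} (hf : Sm f) (x y : ℝ) (k : ℕ) (hk : k ≤ 5) (s : ℝ) :
    HasDerivAt (hh f x y k) (hh f x y (k + 1) s) s := by
  unfold hh
  have := HasDerivAt.fun_sum (u := Finset.range (k + 1)) (x := s)
    (fun i _ => (mm_der hf i (k - i) x y s).const_mul
      ((k.choose i : ℝ) * (x ^ i * y ^ (k - i))))
  refine this.congr_deriv ?_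
  interval_cases k <;> simp [Finset.sum_range_succ, Nat.choose] <;> ring

lemma step_bound (r r1 : ℝ → ℝ) (M : ℝ) (h0 : r 0 = 0) (hd : ∀ s, HasDerivAt r (r1 s) s)
    (hb : ∀ s ∈ Set.Icc (0 : ℝ) 1, |r1 s| ≤ M) : ∀ s ∈ Set.Icc (0 : ℝ) 1, |r s| ≤ M := by
  intro s hs
  have hM : 0 ≤ M := (abs_nonneg _).trans (hb s hs)
  have := Convex.norm_image_sub_le_of_norm_hasDerivWithin_le (f := r) (f' := r1)
    (s := Set.Icc 0 1) (C := M) (x := 0) (y := s) (fun x _ => (hd x).hasDerivWithinAt)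
    (fun x hx => hb x hx) (convex_Icc _ _) (by simp) hs
  rw [h0, sub_zero, sub_zero, Real.norm_eq_abs, Real.norm_eq_abs, abs_of_nonneg hs.1] at this
  nlinarith [hs.2]

lemma taylor1 (h : ℕ → ℝ → ℝ) (M : ℝ) (hd : ∀ k, k ≤ 5 → ∀ s, HasDerivAt (h k) (h (k + 1) s) s)
    (hb : ∀ s ∈ Set.Icc (0 : ℝ) 1, |h 6 s| ≤ M) :
    |h 0 1 - (h 0 0 + h 1 0 + h 2 0 / 2 + h 3 0 / 6 + h 4 0 / 24 + h 5 0 / 120)| ≤ M := by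
  have hp : ∀ (n : ℕ) (a s : ℝ), HasDerivAt (fun s => a * s ^ (n + 1)) (a * ((n + 1) * s ^ n)) s := by
    intro n a s
    have := (hasDerivAt_pow (n + 1) s).const_mul a
    simpa using this
  have s5 := step_bound (fun s => h 5 s - h 5 0) (h 6) M (by simp)
    (fun s => by simpa using (hd 5 (by norm_num) s).sub_const (h 5 0)) hb
  have s4 := step_bound (fun s => h 4 s - h 4 0 - h 5 0 * s ^ (0 + 1)) _ M (by simp)
    (fun s => (((hd 4 (by norm_num) s).sub_const (h 4 0)).sub (hp 0 _ s)).congr_deriv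
      (f' := _) (g' := h 5 s - h 5 0) (by simp)) s5
  have s3 := step_bound (fun s => h 3 s - h 3 0 - h 4 0 * s ^ (0 + 1) - h 5 0 / 2 * s ^ (1 + 1)) _ M
    (by simp)
    (fun s => ((((hd 3 (by norm_num) s).sub_const (h 3 0)).sub (hp 0 _ s)).sub
      (hp 1 _ s)).congr_deriv
      (f' := _) (g' := h 4 s - h 4 0 - h 5 0 * s ^ (0 + 1)) (by norm_num; ring)) s4
  have s2 := step_bound (fun s => h 2 s - h 2 0 - h 3 0 * s ^ (0 + 1) - h 4 0 / 2 * s ^ (1 + 1)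
      - h 5 0 / 6 * s ^ (2 + 1)) _ M
    (by simp)
    (fun s => (((((hd 2 (by norm_num) s).sub_const (h 2 0)).sub (hp 0 _ s)).sub
      (hp 1 _ s)).sub (hp 2 _ s)).congr_deriv
      (f' := _) (g' := h 3 s - h 3 0 - h 4 0 * s ^ (0 + 1) - h 5 0 / 2 * s ^ (1 + 1))
      (by norm_num; ring)) s3
  have s1 := step_bound (fun s => h 1 s - h 1 0 - h 2 0 * s ^ (0 + 1) - h 3 0 / 2 * s ^ (1 + 1)
      - h 4 0 / 6 * s ^ (2 + 1) - h 5 0 / 24 * s ^ (3 + 1)) _ M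
    (by simp)
    (fun s => ((((((hd 1 (by norm_num) s).sub_const (h 1 0)).sub (hp 0 _ s)).sub
      (hp 1 _ s)).sub (hp 2 _ s)).sub (hp 3 _ s)).congr_deriv
      (f' := _) (g' := h 2 s - h 2 0 - h 3 0 * s ^ (0 + 1) - h 4 0 / 2 * s ^ (1 + 1)
      - h 5 0 / 6 * s ^ (2 + 1))
      (by norm_num; ring)) s2
  have s0 := step_bound (fun s => h 0 s - h 0 0 - h 1 0 * s ^ (0 + 1) - h 2 0 / 2 * s ^ (1 + 1)
      - h 3 0 / 6 * s ^ (2 + 1) - h 4 0 / 24 * s ^ (3 + 1) - h 5 0 / 120 * s ^ (4 + 1)) _ M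
    (by simp)
    (fun s => (((((((hd 0 (by norm_num) s).sub_const (h 0 0)).sub (hp 0 _ s)).sub
      (hp 1 _ s)).sub (hp 2 _ s)).sub (hp 3 _ s)).sub (hp 4 _ s)).congr_deriv
      (f' := _) (g' := h 1 s - h 1 0 - h 2 0 * s ^ (0 + 1) - h 3 0 / 2 * s ^ (1 + 1)
      - h 4 0 / 6 * s ^ (2 + 1) - h 5 0 / 24 * s ^ (3 + 1))
      (by norm_num; ring)) s1
  have := s0 1 (by simp)
  refine le_trans (le_of_eq ?_) this
  congr 1; norm_num; ring

lemma taylor2 (f : ℝ → ℝ → ℝ) (hf : Sm f) : ∃ M, 0 ≤ M ∧ ∀ x y : ℝ, |x| + |y| ≤ 1 →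
    |f x y - (hh f x y 0 0 + hh f x y 1 0 + hh f x y 2 0 / 2 + hh f x y 3 0 / 6
      + hh f x y 4 0 / 24 + hh f x y 5 0 / 120)| ≤ M * (|x| + |y|) ^ 6 := by
  have hK : IsCompact (Set.Icc (-1 : ℝ) 1 ×ˢ Set.Icc (-1 : ℝ) 1) := isCompact_Icc.prod isCompact_Icc
  have hB : ∀ i j, ∃ C, ∀ p ∈ Set.Icc (-1 : ℝ) 1 ×ˢ Set.Icc (-1 : ℝ) 1,
      ‖mm f i j p.1 p.2‖ ≤ C := fun i j =>
    hK.exists_bound_of_continuousOn (ContDiff.continuous (mm_sm hf i j)).continuousOn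
  choose B hB using hB
  set M := ∑ i ∈ Finset.range 7, |B i (6 - i)| with hM
  have hM0 : 0 ≤ M := Finset.sum_nonneg fun i _ => abs_nonneg _
  refine ⟨M, hM0, fun x y hxy => ?_⟩
  have hx := abs_nonneg x; have hy := abs_nonneg y
  have := taylor1 (hh f x y) (M * (|x| + |y|) ^ 6) (fun k hk s => hh_der hf x y k hk s) ?_
  · convert this using 3
    simp [hh, mm]
  · intro s hs
    have hmem : (s * x, s * y) ∈ Set.Icc (-1 : ℝ) 1 ×ˢ Set.Icc (-1 : ℝ) 1 := by
      have h1 : |s * x| ≤ 1 := by rw [abs_mul, abs_of_nonneg hs.1]; nlinarith [hs.1, hs.2]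
      have h2 : |s * y| ≤ 1 := by rw [abs_mul, abs_of_nonneg hs.1]; nlinarith [hs.1, hs.2]
      exact ⟨abs_le.1 h1, abs_le.1 h2⟩
    have hMi : ∀ i ∈ Finset.range 7, |mm f i (6 - i) (s * x) (s * y)| ≤ M := by
      intro i hi
      refine (hB i (6 - i) _ hmem).trans ((le_abs_self _).trans ?_)
      exact Finset.single_le_sum (f := fun i => |B i (6 - i)|) (fun i _ => abs_nonneg _) hi
    unfold hh
    refine (Finset.abs_sum_le_sum_abs _ _).trans ?_
    rw [add_pow, Finset.mul_sum]
    refine Finset.sum_le_sum fun i hi => ?_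
    rw [abs_mul, abs_mul, abs_mul, abs_pow, abs_pow, Nat.abs_cast]
    have := hMi i hi
    calc _ ≤ ((6 : ℕ).choose i : ℝ) * (|x| ^ i * |y| ^ (6 - i)) * M := by gcongr
      _ = _ := by ring

/-- Quadratic form. -/
noncomputable def Q2 (a b c : ℝ) (p : ℝ × ℝ) : ℝ := (a * p.1 ^ 2 + 2 * b * p.1 * p.2 + c * p.2 ^ 2) / 2
/-- Cubic form. -/
def Q3 (a b c d : ℝ) (p : ℝ × ℝ) : ℝ :=
  a * p.1 ^ 3 + b * p.1 ^ 2 * p.2 + c * p.1 * p.2 ^ 2 + d * p.2 ^ 3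
/-- Quartic form. -/
def Q4 (a b c d e : ℝ) (p : ℝ × ℝ) : ℝ :=
  a * p.1 ^ 4 + b * p.1 ^ 3 * p.2 + c * p.1 ^ 2 * p.2 ^ 2 + d * p.1 * p.2 ^ 3 + e * p.2 ^ 4
/-- Quintic form. -/
def Q5 (a b c d e k : ℝ) (p : ℝ × ℝ) : ℝ :=
  a * p.1 ^ 5 + b * p.1 ^ 4 * p.2 + c * p.1 ^ 3 * p.2 ^ 2 + d * p.1 ^ 2 * p.2 ^ 3
    + e * p.1 * p.2 ^ 4 + k * p.2 ^ 5

lemma taylor3 (f : ℝ → ℝ → ℝ) (hf : Sm f)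
    (h0 : f 0 0 = 0) (hfx : pdx f 0 0 = 0) (hfy : pdy f 0 0 = 0) :
    ∃ c0 c1 c2 c3 d1 d3 e0 e1 e2 e3 e4 e5 M : ℝ, 0 ≤ M ∧ ∀ p : ℝ × ℝ, |p.1| + |p.2| ≤ 1 →
      |f p.1 p.2 - (Q2 (pdx (pdx f) 0 0) (pdx (pdy f) 0 0) (pdy (pdy f) 0 0) p + Q3 c0 c1 c2 c3 p
        + Q4 (pdx (pdx (pdx (pdx f))) 0 0 / 24) d1 (pdx (pdx (pdy (pdy f))) 0 0 / 4) d3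
          (pdy (pdy (pdy (pdy f))) 0 0 / 24) p + Q5 e0 e1 e2 e3 e4 e5 p)|
        ≤ M * (|p.1| + |p.2|) ^ 6 := by
  obtain ⟨M, hM, h⟩ := taylor2 f hf
  refine ⟨mm f 3 0 0 0 / 6, mm f 2 1 0 0 / 2, mm f 1 2 0 0 / 2, mm f 0 3 0 0 / 6,
    mm f 3 1 0 0 / 6, mm f 1 3 0 0 / 6,
    mm f 5 0 0 0 / 120, mm f 4 1 0 0 / 24, mm f 3 2 0 0 / 12, mm f 2 3 0 0 / 12, mm f 1 4 0 0 / 24,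
    mm f 0 5 0 0 / 120, M, hM, fun p hp => ?_⟩
  refine le_trans (le_of_eq ?_) (h p.1 p.2 hp)
  have a00 : mm f 0 0 0 0 = 0 := h0
  have a10 : mm f 1 0 0 0 = 0 := hfx
  have a01 : mm f 0 1 0 0 = 0 := hfy
  have a20 : mm f 2 0 0 0 = pdx (pdx f) 0 0 := rfl
  have a11 : mm f 1 1 0 0 = pdx (pdy f) 0 0 := rfl
  have a02 : mm f 0 2 0 0 = pdy (pdy f) 0 0 := rfl
  have a40 : mm f 4 0 0 0 = pdx (pdx (pdx (pdx f))) 0 0 := rfl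
  have a22 : mm f 2 2 0 0 = pdx (pdx (pdy (pdy f))) 0 0 := rfl
  have a04 : mm f 0 4 0 0 = pdy (pdy (pdy (pdy f))) 0 0 := rfl
  rw [← a20, ← a11, ← a02, ← a40, ← a22, ← a04]
  congr 2
  unfold hh Q2 Q3 Q4 Q5
  simp only [Finset.sum_range_succ, Finset.sum_range_zero, Nat.reduceSub, Nat.sub_zero, zero_add]
  simp [Nat.choose, a00, a10, a01]
  ring

end

section
open MeasureTheory ProbabilityTheory Filter Topology

/-- `X τ a = O(τ ^ n)` with polynomial weight `w`. -/
def BO {α : Type*} (w : α → ℝ) (n : ℕ) (X : ℝ → α → ℝ) : Prop :=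
  ∃ (C : ℝ) (k : ℕ), 0 ≤ C ∧ ∀ᶠ τ in 𝓝[>] (0 : ℝ), ∀ a, |X τ a| ≤ C * τ ^ n * w a ^ k

lemma ev_pos : ∀ᶠ τ in 𝓝[>] (0 : ℝ), 0 < τ := eventually_mem_nhdsWithin

lemma ev_lt {c : ℝ} (hc : 0 < c) : ∀ᶠ τ in 𝓝[>] (0 : ℝ), τ < c :=
  (eventually_lt_nhds hc).filter_mono nhdsWithin_le_nhds

namespace BO
variable {α β : Type*} {w : α → ℝ} {v : β → ℝ} {n m : ℕ} {X Y : ℝ → α → ℝ}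

lemma mono (hX : BO w n X) (h : ∀ᶠ τ in 𝓝[>] (0 : ℝ), ∀ a, |Y τ a| ≤ |X τ a|) : BO w n Y := by
  obtain ⟨C, k, hC, hX⟩ := hX
  refine ⟨C, k, hC, ?_⟩
  filter_upwards [hX, h] with τ h1 h2 a
  exact (h2 a).trans (h1 a)

lemma congr (hX : BO w n X) (h : ∀ᶠ τ in 𝓝[>] (0 : ℝ), ∀ a, Y τ a = X τ a) : BO w n Y :=
  hX.mono (h.mono fun τ h a => by rw [h a])

lemma congr' (hX : BO w n X) (h : ∀ τ a, Y τ a = X τ a) : BO w n Y :=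
  hX.congr (Eventually.of_forall h)

lemma neg (hX : BO w n X) : BO w n (fun τ a => - X τ a) :=
  hX.mono (Eventually.of_forall fun τ a => by rw [abs_neg])

lemma abs (hX : BO w n X) : BO w n (fun τ a => |X τ a|) :=
  hX.mono (Eventually.of_forall fun τ a => by rw [abs_abs])

lemma add (hw : ∀ a, 1 ≤ w a) (hX : BO w n X) (hY : BO w n Y) :
    BO w n (fun τ a => X τ a + Y τ a) := by
  obtain ⟨C, k, hC, hX⟩ := hX
  obtain ⟨D, l, hD, hY⟩ := hY
  refine ⟨C + D, max k l, by positivity, ?_⟩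
  filter_upwards [hX, hY, ev_pos] with τ h1 h2 h3 a
  have e1 : w a ^ k ≤ w a ^ max k l := pow_le_pow_right₀ (hw a) (le_max_left _ _)
  have e2 : w a ^ l ≤ w a ^ max k l := pow_le_pow_right₀ (hw a) (le_max_right _ _)
  calc _ ≤ |X τ a| + |Y τ a| := abs_add_le _ _
    _ ≤ C * τ ^ n * w a ^ k + D * τ ^ n * w a ^ l := add_le_add (h1 a) (h2 a)
    _ ≤ C * τ ^ n * w a ^ max k l + D * τ ^ n * w a ^ max k l := by gcongr
    _ = _ := by ring

lemma sub (hw : ∀ a, 1 ≤ w a) (hX : BO w n X) (hY : BO w n Y) :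
    BO w n (fun τ a => X τ a - Y τ a) :=
  (hX.add hw hY.neg).congr' fun τ a => by ring

lemma mul (hX : BO w n X) (hY : BO w m Y) :
    BO w (n + m) (fun τ a => X τ a * Y τ a) := by
  obtain ⟨C, k, hC, hX⟩ := hX
  obtain ⟨D, l, hD, hY⟩ := hY
  refine ⟨C * D, k + l, by positivity, ?_⟩
  filter_upwards [hX, hY, ev_pos] with τ h1 h2 h3 a
  rw [abs_mul]
  calc _ ≤ (C * τ ^ n * w a ^ k) * (D * τ ^ m * w a ^ l) :=
        mul_le_mul (h1 a) (h2 a) (abs_nonneg _) ((abs_nonneg _).trans (h1 a))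
    _ = _ := by ring

lemma mul' {j : ℕ} (hX : BO w n X) (hY : BO w m Y) (hj : n + m = j) :
    BO w j (fun τ a => X τ a * Y τ a) := hj ▸ hX.mul hY

lemma tau (w : α → ℝ) (n : ℕ) : BO w n (fun τ _ => τ ^ n) :=
  ⟨1, 0, by norm_num, by
    filter_upwards [ev_pos] with τ h a
    rw [abs_of_pos (by positivity)]; simp⟩

lemma const (w : α → ℝ) (c : ℝ) : BO w 0 (fun _ _ => c) :=
  ⟨|c|, 0, abs_nonneg _, Eventually.of_forall fun τ a => by simp⟩

lemma const_mul (c : ℝ) (hX : BO w n X) : BO w n (fun τ a => c * X τ a) :=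
  (const w c).mul' hX (zero_add n)

lemma tau_mul {j : ℕ} (hX : BO w n X) (m : ℕ) (hj : m + n = j) : BO w j (fun τ a => τ ^ m * X τ a) :=
  (tau w m).mul' hX hj

lemma weaken (hX : BO w n X) (h : m ≤ n) : BO w m X := by
  have h1 : BO w m (fun τ a => X τ a) := by
    obtain ⟨C, k, hC, hX⟩ := hX
    refine ⟨C, k, hC, ?_⟩
    filter_upwards [hX, ev_pos, ev_lt one_pos] with τ h1 h2 h3 a
    refine (h1 a).trans ?_
    have e := h1 a
    by_cases hC0 : C * w a ^ k < 0
    · exfalso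
      have := abs_nonneg (X τ a)
      have h4 : C * τ ^ n * w a ^ k = τ ^ n * (C * w a ^ k) := by ring
      have h5 : τ ^ n * (C * w a ^ k) < 0 := mul_neg_of_pos_of_neg (by positivity) hC0
      linarith
    · have := pow_le_pow_of_le_one h2.le h3.le h
      calc C * τ ^ n * w a ^ k = (C * w a ^ k) * τ ^ n := by ring
        _ ≤ (C * w a ^ k) * τ ^ m := mul_le_mul_of_nonneg_left this (not_lt.1 hC0)
        _ = _ := by ring
  exact h1

lemma pow (hX : BO w 0 X) (j : ℕ) : BO w 0 (fun τ a => X τ a ^ j) := by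
  induction j with
  | zero => simpa using const w 1
  | succ j ih => exact (ih.mul' hX rfl).congr' fun τ a => by rw [pow_succ]

lemma comp (hX : BO w n X) (φ : β → α) (D : ℝ) (hD : 0 ≤ D) (hw : ∀ a, 1 ≤ w a)
    (h : ∀ b, w (φ b) ≤ D * v b) : BO v n (fun τ b => X τ (φ b)) := by
  obtain ⟨C, k, hC, hX⟩ := hX
  refine ⟨C * D ^ k, k, by positivity, ?_⟩
  filter_upwards [hX, ev_pos] with τ h1 h2 b
  have h4 : w (φ b) ^ k ≤ D ^ k * v b ^ k := by
    rw [← mul_pow]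
    exact pow_le_pow_left₀ (by linarith [hw (φ b)]) (h b) k
  calc _ ≤ C * τ ^ n * w (φ b) ^ k := h1 _
    _ ≤ C * τ ^ n * (D ^ k * v b ^ k) := by gcongr
    _ = _ := by ring

lemma integral [MeasurableSpace β] (ν : Measure β) (hv : ∀ k : ℕ, Integrable (fun b => v b ^ k) ν)
    {Z : ℝ → α × β → ℝ} (hw : ∀ a, 1 ≤ w a) (hZ : BO (fun p : α × β => w p.1 * v p.2) n Z) :
    BO w n (fun τ a => ∫ b, Z τ (a, b) ∂ν) := by
  obtain ⟨C, k, hC, hZ⟩ := hZ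
  refine ⟨C * |∫ b, v b ^ k ∂ν|, k, by positivity, ?_⟩
  filter_upwards [hZ, ev_pos] with τ h1 h2 a
  have h := norm_integral_le_of_norm_le (f := fun b => Z τ (a, b)) (μ := ν)
    ((hv k).const_mul (C * τ ^ n * w a ^ k))
    (Eventually.of_forall fun b => by
      have := h1 (a, b)
      rw [Real.norm_eq_abs]
      refine this.trans (le_of_eq ?_)
      simp only [mul_pow]; ring)
  rw [integral_const_mul, Real.norm_eq_abs] at h
  have hw0 : 0 ≤ w a := by linarith [hw a]
  calc _ ≤ C * τ ^ n * w a ^ k * ∫ b, v b ^ k ∂ν := h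
    _ ≤ C * τ ^ n * w a ^ k * |∫ b, v b ^ k ∂ν| := by gcongr; exact le_abs_self _
    _ = _ := by ring

lemma num [MeasurableSpace α] (ν : Measure α) (hv : ∀ k : ℕ, Integrable (fun b => w b ^ k) ν)
    (hw : ∀ a, 1 ≤ w a) (hX : BO w n X) : BO (fun _ : Unit => (1 : ℝ)) n (fun τ _ => ∫ b, X τ b ∂ν) := by
  have := integral (w := fun _ : Unit => (1 : ℝ)) (v := w) (n := n) ν hv (Z := fun τ p => X τ p.2)
    (fun _ => le_rfl) (hX.comp (v := fun p : Unit × α => 1 * w p.2) Prod.snd 1 zero_le_one hw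
      (fun b => by simp))
  exact this

lemma integrable [MeasurableSpace α] (ν : Measure α) (hv : ∀ k : ℕ, Integrable (fun b => w b ^ k) ν)
    (hX : BO w n X) (hm : ∀ τ, Measurable (X τ)) : ∀ᶠ τ in 𝓝[>] (0 : ℝ), Integrable (X τ) ν := by
  obtain ⟨C, k, hC, hX⟩ := hX
  filter_upwards [hX] with τ h
  exact ((hv k).const_mul (C * τ ^ n)).mono' (hm τ).aestronglyMeasurable
    (Eventually.of_forall fun a => h a)

lemma integrable_const [MeasurableSpace α] (ν : Measure α)
    (hv : ∀ k : ℕ, Integrable (fun b => w b ^ k) ν) {F : α → ℝ}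
    (hX : BO w n (fun _ => F)) (hm : Measurable F) : Integrable F ν :=
  (hX.integrable ν hv fun _ => hm).exists.choose_spec

end BO

end

section
open MeasureTheory ProbabilityTheory Filter Topology

lemma BO.integrable_param {α β : Type*} {w : α → ℝ} {v : β → ℝ} {n : ℕ} [MeasurableSpace β]
    (ν : Measure β) (hv : ∀ k : ℕ, Integrable (fun b => v b ^ k) ν)
    {Z : ℝ → α × β → ℝ} (hZ : BO (fun p : α × β => w p.1 * v p.2) n Z)
    (hm : ∀ τ a, Measurable (fun b => Z τ (a, b))) :
    ∀ᶠ τ in 𝓝[>] (0 : ℝ), ∀ a, Integrable (fun b => Z τ (a, b)) ν := by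
  obtain ⟨C, k, hC, hZ⟩ := hZ
  filter_upwards [hZ] with τ h a
  refine ((hv k).const_mul (C * τ ^ n * w a ^ k)).mono' (hm τ a).aestronglyMeasurable
    (Eventually.of_forall fun b => ?_)
  rw [Real.norm_eq_abs]
  refine (h (a, b)).trans (le_of_eq ?_)
  simp only [mul_pow]; ring

/-- Divide by one power of the parameter. -/
lemma BO.div_tau {α : Type*} {w : α → ℝ} {n m : ℕ} {X : ℝ → α → ℝ}
    (h : BO w (n + m) (fun τ a => τ ^ m * X τ a)) : BO w n X := by
  obtain ⟨C, k, hC, h⟩ := h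
  refine ⟨C, k, hC, ?_⟩
  filter_upwards [h, ev_pos] with τ h1 h2 a
  have h3 := h1 a
  have hp : 0 < τ ^ m := by positivity
  rw [abs_mul, abs_of_pos hp, pow_add] at h3
  refine le_of_mul_le_mul_left ?_ hp
  calc _ ≤ _ := h3
    _ = _ := by ring

lemma BO.pow' {α : Type*} {w : α → ℝ} {n : ℕ} {X : ℝ → α → ℝ} (hX : BO w n X) (j : ℕ) :
    BO w (n * j) (fun τ a => X τ a ^ j) := by
  induction j with
  | zero => simpa using BO.const w 1
  | succ j ih => exact (ih.mul' hX (by ring)).congr' fun τ a => by rw [pow_succ]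

lemma expand_pt {α : Type*} {w : α → ℝ} (hw : ∀ a, 1 ≤ w a) {g T Z : ℝ → α → ℝ}
    (h1 : BO w 5 (fun τ a => min (τ * |g τ a - T τ a|) 1)) (hT : BO w 0 T) (hZ : BO w 0 Z)
    (c : ℝ) (hc : 0 < c) (hc1 : c ≤ 1) :
    BO w 5 (fun τ a => EE (c * τ * (g τ a - Z τ a))
      - (c * τ * (T τ a - Z τ a) - (c * τ) ^ 3 / 6 * (T τ a - Z τ a) ^ 3)) := by
  have h2 := ((hT.sub hw hZ).abs.pow 5).tau_mul 5 (j := 5) rfl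
  refine ((h1.const_mul 3).add hw h2).mono ?_
  filter_upwards [ev_pos] with τ hτ a
  have hcτ : c * τ ≤ τ := by nlinarith
  refine (EE_expand (c * τ) (g τ a) (T τ a) (Z τ a) (by positivity)).trans ((le_abs_self _).trans' ?_)
  have : (c * τ) ^ 5 ≤ τ ^ 5 := by gcongr
  gcongr

lemma lower_pt {α : Type*} [MeasurableSpace α] (ν : Measure α) [IsProbabilityMeasure ν]
    (u : α → ℝ) (hu : Measurable u) (s : ℝ) (h : ∫ a, EE (u a - s) ∂ν = 0) :
    Real.exp (-2) * min |s| 1 * (1 - ∫ a, min |u a| 1 ∂ν) ≤ |∫ a, EE (u a) ∂ν| := by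
  have hi : Integrable (fun a => min |u a| 1) ν :=
    Integrable.of_bound (by fun_prop) 1
      (Eventually.of_forall fun a => by
        rw [Real.norm_of_nonneg (le_min (abs_nonneg _) zero_le_one)]; exact min_le_right _ _)
  have hm0 : 0 ≤ min |s| 1 := le_min (abs_nonneg _) zero_le_one
  have he : 0 ≤ Real.exp (-2) * min |s| 1 := by positivity
  have i1 := EE_comp_int ν u hu
  have i2 := EE_comp_int ν (fun a => u a - s) (by fun_prop)
  have e1 : Real.exp (-2) * min |s| 1 * (1 - ∫ a, min |u a| 1 ∂ν)
      = ∫ a, Real.exp (-2) * min |s| 1 * (1 - min |u a| 1) ∂ν := by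
    rw [integral_const_mul, integral_sub (integrable_const _) hi]; simp
  have i3 : Integrable (fun a => Real.exp (-2) * min |s| 1 * (1 - min |u a| 1)) ν :=
    ((integrable_const _).sub hi).const_mul _
  rw [e1]
  have hmono := EE_strictMono.monotone
  rcases le_total 0 s with hs | hs
  · refine le_trans ?_ (le_abs_self _)
    have : ∫ a, EE (u a) ∂ν = ∫ a, (EE (u a) - EE (u a - s)) ∂ν := by
      rw [integral_sub i1 i2, h, sub_zero]
    rw [this]
    refine integral_mono i3 (i1.sub i2) fun a => ?_
    dsimp only
    rcases le_total |u a| 1 with h1 | h1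
    · have h2 := EE_lower_neg' (u a) (u a - s) h1 (by linarith)
      rw [sub_sub_cancel] at h2
      refine le_trans ?_ h2
      have : 0 ≤ min |u a| 1 := le_min (abs_nonneg _) zero_le_one
      nlinarith
    · rw [min_eq_right h1]
      have := hmono (show u a - s ≤ u a by linarith)
      simp; linarith
  · refine le_trans ?_ (neg_le_abs _)
    have : - ∫ a, EE (u a) ∂ν = ∫ a, (EE (u a - s) - EE (u a)) ∂ν := by
      rw [integral_sub i2 i1, h, zero_sub]
    rw [this]
    refine integral_mono i3 (i2.sub i1) fun a => ?_
    dsimp only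
    rcases le_total |u a| 1 with h1 | h1
    · have h2 := EE_lower_pos' (u a) (u a - s) h1 (by linarith)
      rw [sub_sub_cancel] at h2
      refine le_trans ?_ h2
      have : 0 ≤ min |u a| 1 := le_min (abs_nonneg _) zero_le_one
      nlinarith
    · rw [min_eq_right h1]
      have := hmono (show u a ≤ u a - s by linarith)
      simp; linarith

lemma lower_BO {α : Type*} {w : α → ℝ} (hw : ∀ a, 1 ≤ w a) {m I J : ℝ → α → ℝ}
    (hm0 : ∀ τ a, 0 ≤ m τ a) (hm1 : ∀ τ a, m τ a ≤ 1)
    (hI : BO w 5 I) (hJ : BO w 1 J)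
    (h : ∀ᶠ τ in 𝓝[>] (0 : ℝ), ∀ a, Real.exp (-2) * m τ a * (1 - J τ a) ≤ |I τ a|) :
    BO w 5 m := by
  obtain ⟨D, l, hD, hJ⟩ := hJ
  have h2 : BO w 5 (fun τ a => (2 * D * τ * w a ^ l) ^ 5) := by
    refine ⟨(2 * D) ^ 5, l * 5, by positivity, ?_⟩
    filter_upwards [ev_pos] with τ hτ a
    have := hw a
    rw [abs_of_nonneg (by positivity)]
    refine le_of_eq ?_
    rw [pow_mul]; ring
  refine ((hI.abs.const_mul (2 * Real.exp 2)).add hw h2).mono ?_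
  filter_upwards [h, hJ, ev_pos] with τ h3 h4 hτ a
  have hwa := hw a
  rw [abs_of_nonneg (hm0 τ a)]
  refine le_trans ?_ (le_abs_self _)
  have hx : 0 ≤ 2 * D * τ * w a ^ l := by positivity
  have hI0 := abs_nonneg (I τ a)
  rcases le_total (D * τ ^ 1 * w a ^ l) (1 / 2) with h5 | h5
  · have h6 : J τ a ≤ 1 / 2 := (le_abs_self _).trans ((h4 a).trans h5)
    have h7 := h3 a
    have h8 : Real.exp (-2) * m τ a * (1 / 2) ≤ |I τ a| := by
      refine le_trans ?_ h7
      have := mul_nonneg (Real.exp_pos (-2)).le (hm0 τ a)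
      gcongr
      linarith
    have h9 : Real.exp 2 * Real.exp (-2) = 1 := by rw [← Real.exp_add]; simp
    have h10 : m τ a ≤ 2 * Real.exp 2 * |I τ a| := by
      calc m τ a = 2 * Real.exp 2 * (Real.exp (-2) * m τ a * (1 / 2)) := by
            linear_combination (- m τ a) * h9
        _ ≤ _ := by gcongr
    have : 0 ≤ (2 * D * τ * w a ^ l) ^ 5 := by positivity
    linarith
  · have h6 : 1 ≤ 2 * D * τ * w a ^ l := by
      calc (1 : ℝ) ≤ 2 * (D * τ ^ 1 * w a ^ l) := by linarith
        _ = _ := by ring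
    have h7 := one_le_pow₀ h6 (n := 5)
    have : 0 ≤ 2 * Real.exp 2 * |I τ a| := by positivity
    linarith [hm1 τ a]

/-- the cube lemma -/
lemma cube_lemma {α : Type*} [MeasurableSpace α] [AddGroup α] [MeasurableNeg α] (ν : Measure α)
    (hν : ν.map (fun x => -x) = ν) {w : α → ℝ} (hw : ∀ a, 1 ≤ w a)
    (hv : ∀ k : ℕ, Integrable (fun b => w b ^ k) ν) (X : ℝ → α → ℝ) (X0 X1 : α → ℝ)
    (hX : ∀ τ, Measurable (X τ)) (hX0 : Measurable X0) (hX1 : Measurable X1)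
    (b0 : BO w 0 (fun _ => X0)) (b1 : BO w 0 (fun _ => X1))
    (hev : ∀ a, X0 (-a) = X0 a) (hod : ∀ a, X1 (-a) = - X1 a)
    (hR : BO w 2 (fun τ a => X τ a - X0 a - τ * X1 a)) :
    BO (fun _ : Unit => (1 : ℝ)) 2 (fun τ _ => ∫ a, X τ a ^ 3 ∂ν - ∫ a, X0 a ^ 3 ∂ν) := by
  have bt : BO w 0 (fun τ _ => τ) := ((BO.tau w 1).congr' fun τ a => by simp).weaken (by norm_num)
  have bs : BO w 0 (fun τ a => X0 a + τ * X1 a) := b0.add hw (bt.mul' b1 rfl)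
  have bY := hR.weaken (m := 0) (by norm_num)
  have key : BO w 2 (fun τ a => X τ a ^ 3 - X0 a ^ 3 - 3 * τ * (X0 a ^ 2 * X1 a)) := by
    have t1 : BO w 2 (fun τ a => τ ^ 2 * (3 * X0 a * X1 a ^ 2 + τ * X1 a ^ 3)) :=
      (((b0.const_mul 3).mul' (b1.pow 2) rfl).add hw (bt.mul' (b1.pow 3) rfl)).tau_mul 2 rfl
    have t2 : BO w 2 (fun τ a => (X τ a - X0 a - τ * X1 a) * (3 * (X0 a + τ * X1 a) ^ 2
        + 3 * (X0 a + τ * X1 a) * (X τ a - X0 a - τ * X1 a) + (X τ a - X0 a - τ * X1 a) ^ 2)) :=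
      hR.mul' ((((bs.pow 2).const_mul 3).add hw ((bs.const_mul 3).mul' bY rfl)).add hw (bY.pow 2)) rfl
    refine (t1.add hw t2).congr' fun τ a => ?_
    ring
  have bX : BO w 0 X := (bY.add hw bs).congr' fun τ a => by ring
  have i1 := (bX.pow 3).integrable ν hv (fun τ => (hX τ).pow_const 3)
  have i2 : Integrable (fun a => X0 a ^ 3) ν := (b0.pow 3).integrable_const ν hv (hX0.pow_const 3)
  have i3 : Integrable (fun a => X0 a ^ 2 * X1 a) ν :=
    ((b0.pow 2).mul' b1 rfl).integrable_const ν hv ((hX0.pow_const 2).mul hX1)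
  have o := odd_int ν hν (fun a => X0 a ^ 2 * X1 a) (fun a => by simp only [hev, hod]; ring)
  refine (key.num ν hv hw).congr ?_
  filter_upwards [i1] with τ i1 _
  have i12 : Integrable (fun a => X τ a ^ 3 - X0 a ^ 3) ν := i1.sub i2
  rw [integral_sub i12 (i3.const_mul _), integral_sub i1 i2, integral_const_mul, o]
  ring

end

section
open MeasureTheory ProbabilityTheory Filter Topology

/-- Measurable functions of polynomial growth on the plane. -/
structure PG (F : ℝ × ℝ → ℝ) : Prop where
  meas : Measurable F
  bo : BO ww 0 (fun _ => F)

/-- product weight -/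
def w2 (p : (ℝ × ℝ) × (ℝ × ℝ)) : ℝ := ww p.1 * ww p.2

lemma w2_one (p) : 1 ≤ w2 p := one_le_mul_of_one_le_of_one_le (ww_one _) (ww_one _)

lemma w2_int (k : ℕ) : Integrable (fun p => w2 p ^ k) (gga.prod gga) := by
  have := (gga_int_ww k).mul_prod (gga_int_ww k)
  refine this.congr (Eventually.of_forall fun p => ?_)
  simp [w2, mul_pow]

/-- Gaussian average of translates. -/
noncomputable def cv (F : ℝ × ℝ → ℝ) (ξ : ℝ × ℝ) : ℝ := ∫ η, F (ξ + η) ∂gga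

lemma bo_shift {n : ℕ} {X : ℝ → ℝ × ℝ → ℝ} (h : BO ww n X) :
    BO w2 n (fun τ p => X τ (p.1 + p.2)) :=
  h.comp (fun p : (ℝ × ℝ) × (ℝ × ℝ) => p.1 + p.2) 1 zero_le_one ww_one
    (fun p => by rw [one_mul]; exact ww_add _ _)

lemma bo_fst {n : ℕ} {X : ℝ → ℝ × ℝ → ℝ} (h : BO ww n X) :
    BO w2 n (fun τ p => X τ p.1) :=
  h.comp (fun p : (ℝ × ℝ) × (ℝ × ℝ) => p.1) 1 zero_le_one ww_one
    (fun p => by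
      rw [one_mul]
      exact le_mul_of_one_le_right (by linarith [ww_one p.1]) (ww_one _))

lemma bo_scale {n : ℕ} {X : ℝ → ℝ × ℝ → ℝ} (h : BO ww n X) :
    BO ww n (fun τ p => X τ (√2 • p)) :=
  h.comp (fun p : (ℝ × ℝ) => √2 • p) (√2) (by positivity) ww_one
    (fun p => by
      have : (1 : ℝ) ≤ √2 := by rw [Real.one_le_sqrt]; norm_num
      simp only [ww, Prod.smul_fst, Prod.smul_snd, smul_eq_mul, abs_mul, abs_of_nonneg
        (show (0 : ℝ) ≤ √2 by positivity)]
      nlinarith)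

lemma meas_param {F : (ℝ × ℝ) × (ℝ × ℝ) → ℝ} (hF : Measurable F) :
    Measurable (fun ξ => ∫ η, F (ξ, η) ∂gga) :=
  (StronglyMeasurable.integral_prod_right' hF.stronglyMeasurable).measurable

lemma bo_int {n : ℕ} {Z : ℝ → (ℝ × ℝ) × (ℝ × ℝ) → ℝ} (h : BO w2 n Z) :
    BO ww n (fun τ ξ => ∫ η, Z τ (ξ, η) ∂gga) :=
  BO.integral (w := ww) (v := ww) gga gga_int_ww ww_one h

lemma bo_integrable {n : ℕ} {Z : ℝ → (ℝ × ℝ) × (ℝ × ℝ) → ℝ} (h : BO w2 n Z)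
    (hm : ∀ τ a, Measurable (fun b => Z τ (a, b))) :
    ∀ᶠ τ in 𝓝[>] (0 : ℝ), ∀ a, Integrable (fun b => Z τ (a, b)) gga :=
  BO.integrable_param (w := ww) (v := ww) gga gga_int_ww h hm

lemma PG.cv {F : ℝ × ℝ → ℝ} (h : PG F) : PG (cv F) :=
  ⟨meas_param (F := fun p => F (p.1 + p.2)) (h.meas.comp (by fun_prop)),
    bo_int (bo_shift h.bo)⟩

lemma PG.int {F : ℝ × ℝ → ℝ} (h : PG F) : Integrable F gga :=
  h.bo.integrable_const gga gga_int_ww h.meas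

lemma PG.int_shift {F : ℝ × ℝ → ℝ} (h : PG F) (ξ : ℝ × ℝ) :
    Integrable (fun η => F (ξ + η)) gga := by
  have := bo_integrable (bo_shift h.bo) (fun τ a => h.meas.comp (by fun_prop))
  exact this.exists.choose_spec ξ

lemma cv_odd {F : ℝ × ℝ → ℝ} (h : ∀ p, F (-p) = - F p) (ξ : ℝ × ℝ) : cv F (-ξ) = - cv F ξ := by
  unfold cv
  have : ∫ η, F (-ξ + η) ∂gga = ∫ η, F (-ξ + -η) ∂gga := by
    conv_lhs => rw [← gga_neg]
    exact integral_map_equiv (MeasurableEquiv.neg (ℝ × ℝ)) (fun η => F (-ξ + η))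
  rw [this, ← integral_neg]
  refine integral_congr_ae (Eventually.of_forall fun η => ?_)
  dsimp only
  rw [← h]; congr 1; abel

/-- The Taylor polynomial after rescaling. -/
def TT (q c d e : ℝ × ℝ → ℝ) (τ : ℝ) (p : ℝ × ℝ) : ℝ := q p + τ * c p + τ ^ 2 * d p + τ ^ 3 * e p

lemma bo_TT {q c d e : ℝ × ℝ → ℝ} {α : Type*} {w : α → ℝ} (hw : ∀ a, 1 ≤ w a) (φ : α → ℝ × ℝ)
    (hq : BO w 0 (fun _ a => q (φ a))) (hc : BO w 0 (fun _ a => c (φ a)))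
    (hd : BO w 0 (fun _ a => d (φ a))) (he : BO w 0 (fun _ a => e (φ a))) :
    BO w 0 (fun τ a => TT q c d e τ (φ a)) ∧
    BO w 2 (fun τ a => TT q c d e τ (φ a) - q (φ a) - τ * c (φ a)) := by
  have bt : BO w 0 (fun τ _ => τ) := ((BO.tau w 1).congr' fun τ a => by simp).weaken (by norm_num)
  have h2 : BO w 2 (fun τ a => TT q c d e τ (φ a) - q (φ a) - τ * c (φ a)) := by
    refine ((hd.add hw (bt.mul' he rfl)).tau_mul 2 rfl).congr' fun τ a => ?_
    unfold TT; ring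
  refine ⟨((h2.weaken (m := 0) (by norm_num)).add hw (hq.add hw (bt.mul' hc rfl))).congr'
    fun τ a => by ring, h2⟩

lemma meas_TT {q c d e : ℝ × ℝ → ℝ} (hq : PG q) (hc : PG c) (hd : PG d) (he : PG e) (τ : ℝ) :
    Measurable (TT q c d e τ) := by
  have := hq.meas; have := hc.meas; have := hd.meas; have := he.meas
  unfold TT; fun_prop

lemma TT_shift {q c d e : ℝ × ℝ → ℝ} (hq : PG q) (hc : PG c) (hd : PG d) (he : PG e) (τ : ℝ)
    (ξ : ℝ × ℝ) : ∫ η, TT q c d e τ (ξ + η) ∂gga = TT (cv q) (cv c) (cv d) (cv e) τ ξ := by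
  unfold TT cv
  have i1 := hq.int_shift ξ
  have i2 := (hc.int_shift ξ).const_mul τ
  have i3 := (hd.int_shift ξ).const_mul (τ ^ 2)
  have i4 := (he.int_shift ξ).const_mul (τ ^ 3)
  rw [integral_add (by exact (i1.add i2).add i3) i4, integral_add (by exact i1.add i2) i3,
    integral_add i1 i2]
  simp only [integral_const_mul]

lemma TT_int {q c d e : ℝ × ℝ → ℝ} (hq : PG q) (hc : PG c) (hd : PG d) (he : PG e) (τ : ℝ) :
    Integrable (TT q c d e τ) gga ∧
    ∫ η, TT q c d e τ η ∂gga = ∫ η, q η ∂gga + τ * ∫ η, c η ∂gga + τ ^ 2 * ∫ η, d η ∂gga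
      + τ ^ 3 * ∫ η, e η ∂gga := by
  have i1 := hq.int
  have i2 := hc.int.const_mul τ
  have i3 := hd.int.const_mul (τ ^ 2)
  have i4 := he.int.const_mul (τ ^ 3)
  unfold TT
  refine ⟨((i1.add i2).add i3).add i4, ?_⟩
  rw [integral_add (by exact (i1.add i2).add i3) i4, integral_add (by exact i1.add i2) i3,
    integral_add i1 i2]
  simp only [integral_const_mul]

end

section
open MeasureTheory ProbabilityTheory Filter Topology

/-- Averaged Taylor polynomial. -/
noncomputable def BB (q c d e : ℝ × ℝ → ℝ) : ℝ → ℝ × ℝ → ℝ := TT (cv q) (cv c) (cv d) (cv e)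

/-- Third central moment. -/
noncomputable def KK (q c d e : ℝ × ℝ → ℝ) (τ : ℝ) (ξ : ℝ × ℝ) : ℝ :=
  ∫ η, (TT q c d e τ (ξ + η) - BB q c d e τ ξ) ^ 3 ∂gga

/-- Approximate intermediate profile. -/
noncomputable def AA (q c d e : ℝ × ℝ → ℝ) (τ : ℝ) (ξ : ℝ × ℝ) : ℝ :=
  BB q c d e τ ξ - τ ^ 2 * ((1 / 6) * KK q c d e τ ξ)

lemma min_split (a b : ℝ) (hb : 0 ≤ b) : min (a + b) 1 ≤ min a 1 + b := by
  rcases le_total a 1 with h | h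
  · rw [min_eq_left h]; exact min_le_left _ _
  · rw [min_eq_right h]; exact (min_le_right _ _).trans (by linarith)

section
lemma bo_T {q c d e : ℝ × ℝ → ℝ} (hq : PG q) (hc : PG c) (hd : PG d) (he : PG e)
    : BO ww 0 (TT q c d e) := (bo_TT ww_one (fun p => p) hq.bo hc.bo hd.bo he.bo).1

lemma bo_B {q c d e : ℝ × ℝ → ℝ} (hq : PG q) (hc : PG c) (hd : PG d) (he : PG e)
    : BO ww 0 (BB q c d e) := bo_T hq.cv hc.cv hd.cv he.cv

lemma bo_TB {q c d e : ℝ × ℝ → ℝ} (hq : PG q) (hc : PG c) (hd : PG d) (he : PG e)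
    : BO w2 0 (fun τ p => TT q c d e τ (p.1 + p.2) - BB q c d e τ p.1) :=
  (bo_shift (bo_T hq hc hd he)).sub w2_one (bo_fst (bo_B hq hc hd he))

lemma bo_K {q c d e : ℝ × ℝ → ℝ} (hq : PG q) (hc : PG c) (hd : PG d) (he : PG e)
    : BO ww 0 (KK q c d e) := bo_int ((bo_TB hq hc hd he).pow 3)

lemma meas_B {q c d e : ℝ × ℝ → ℝ} (hq : PG q) (hc : PG c) (hd : PG d) (he : PG e)
    (τ : ℝ) : Measurable (BB q c d e τ) := meas_TT hq.cv hc.cv hd.cv he.cv τ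

lemma meas_TB {q c d e : ℝ × ℝ → ℝ} (hq : PG q) (hc : PG c) (hd : PG d) (he : PG e)
    (τ : ℝ) : Measurable (fun p : (ℝ × ℝ) × (ℝ × ℝ) =>
    TT q c d e τ (p.1 + p.2) - BB q c d e τ p.1) :=
  ((meas_TT hq hc hd he τ).comp (by fun_prop)).sub ((meas_B hq hc hd he τ).comp measurable_fst)

lemma meas_K {q c d e : ℝ × ℝ → ℝ} (hq : PG q) (hc : PG c) (hd : PG d) (he : PG e)
    (τ : ℝ) : Measurable (KK q c d e τ) :=
  meas_param ((meas_TB hq hc hd he τ).pow_const 3)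

lemma meas_A {q c d e : ℝ × ℝ → ℝ} (hq : PG q) (hc : PG c) (hd : PG d) (he : PG e)
    (τ : ℝ) : Measurable (AA q c d e τ) := by
  have := meas_B hq hc hd he τ
  have := meas_K hq hc hd he τ
  unfold AA; fun_prop

lemma bo_A {q c d e : ℝ × ℝ → ℝ} (hq : PG q) (hc : PG c) (hd : PG d) (he : PG e)
    : BO ww 0 (AA q c d e) :=
  (bo_B hq hc hd he).sub ww_one
    ((((bo_K hq hc hd he).const_mul (1 / 6)).tau_mul 2 (j := 2) rfl).weaken (by norm_num))

lemma resid_bo {q c d e : ℝ × ℝ → ℝ} (hq : PG q) (hc : PG c) (hd : PG d) (he : PG e)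
    {g : ℝ → ℝ × ℝ → ℝ} (hg : ∀ τ, Measurable (g τ))
    (h : BO ww 5 (fun τ p => min (τ * |g τ p - TT q c d e τ p|) 1)) :
    BO ww 5 (fun τ ξ => ∫ η, EE (τ * (g τ (ξ + η) - AA q c d e τ ξ)) ∂gga) := by
  have bT := bo_shift (bo_T hq hc hd he)
  have bA := bo_fst (bo_A hq hc hd he)
  have bB := bo_fst (bo_B hq hc hd he)
  have bK := bo_fst (bo_K hq hc hd he)
  have bTA := bT.sub w2_one bA
  have bTB := bT.sub w2_one bB
  have h1 := expand_pt w2_one (bo_shift h) bT bA 1 one_pos le_rfl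
  -- the difference of cubes
  have h2 : BO w2 2 (fun τ p => (TT q c d e τ (p.1 + p.2) - BB q c d e τ p.1) ^ 3
      - (TT q c d e τ (p.1 + p.2) - AA q c d e τ p.1) ^ 3) := by
    have := ((((bTB.pow 2).add w2_one (bTB.mul' bTA rfl)).add w2_one (bTA.pow 2)).mul'
      (bK.const_mul (-1 / 6)) rfl).tau_mul 2 (j := 2) rfl
    refine this.congr' fun τ p => ?_
    unfold AA
    ring
  have h3 := (bo_int h1).add ww_one (((bo_int h2).const_mul (1 / 6)).tau_mul 3 (j := 5) rfl)
  have mT : ∀ τ ξ, Measurable (fun η => TT q c d e τ (ξ + η)) := fun τ ξ =>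
    (meas_TT hq hc hd he τ).comp (by fun_prop)
  have i1 := bo_integrable bTA (fun τ a => (mT τ a).sub_const (AA q c d e τ a))
  have i2 := bo_integrable (bTA.pow 3) (fun τ a => ((mT τ a).sub_const (AA q c d e τ a)).pow_const 3)
  have i3 := bo_integrable (bTB.pow 3) (fun τ a => ((mT τ a).sub_const (BB q c d e τ a)).pow_const 3)
  have i4 := bo_integrable bT (fun τ a => mT τ a)
  refine h3.congr ?_
  filter_upwards [i1, i2, i3, i4] with τ i1 i2 i3 i4 ξ
  have iE := EE_comp_int gga (fun η => τ * (g τ (ξ + η) - AA q c d e τ ξ))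
    ((((hg τ).comp (measurable_const_add ξ)).sub_const _).const_mul τ)
  have e1 : ∫ η, (TT q c d e τ (ξ + η) - AA q c d e τ ξ) ∂gga = BB q c d e τ ξ - AA q c d e τ ξ := by
    rw [integral_sub (i4 ξ) (integrable_const _), TT_shift hq hc hd he]
    simp [BB]
  have e2 : ∫ η, (TT q c d e τ (ξ + η) - BB q c d e τ ξ) ^ 3 ∂gga = KK q c d e τ ξ := rfl
  simp only [one_mul]
  rw [integral_sub iE (by exact ((i1 ξ).const_mul τ).sub ((i2 ξ).const_mul (τ ^ 3 / 6))),
    integral_sub ((i1 ξ).const_mul τ) ((i2 ξ).const_mul (τ ^ 3 / 6)), integral_sub (i3 ξ) (i2 ξ),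
    integral_const_mul, integral_const_mul, e1, e2]
  unfold AA
  ring

lemma profile {q c d e : ℝ × ℝ → ℝ} (hq : PG q) (hc : PG c) (hd : PG d) (he : PG e)
    {g gb : ℝ → ℝ × ℝ → ℝ} (hg : ∀ τ, Measurable (g τ))
    (h : BO ww 5 (fun τ p => min (τ * |g τ p - TT q c d e τ p|) 1))
    (hz : ∀ᶠ τ in 𝓝[>] (0 : ℝ), ∀ ξ, ∫ η, EE (τ * (g τ (ξ + η) - gb τ ξ)) ∂gga = 0) :
    BO ww 5 (fun τ p => min (τ * |gb τ p - AA q c d e τ p|) 1) := by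
  have bT := bo_shift (bo_T hq hc hd he)
  have bA := bo_fst (bo_A hq hc hd he)
  have b1 : BO w2 1 (fun τ p => min |τ * (g τ (p.1 + p.2) - AA q c d e τ p.1)| 1) := by
    have := ((bo_shift h).weaken (m := 1) (by norm_num)).add w2_one
      ((bT.sub w2_one bA).abs.tau_mul 1 (j := 1) rfl)
    refine this.mono ?_
    filter_upwards [ev_pos] with τ hτ p
    rw [abs_of_nonneg (le_min (abs_nonneg _) zero_le_one)]
    refine le_trans ?_ (le_abs_self _)
    rw [abs_mul, abs_of_pos hτ, pow_one]
    refine le_trans ?_ (min_split _ _ (by positivity))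
    refine min_le_min_right _ ?_
    rw [← mul_add]
    gcongr
    exact abs_sub_le _ _ _
  have key : BO ww 5 (fun τ p => min |τ * (gb τ p - AA q c d e τ p)| 1) := by
    refine lower_BO ww_one (fun τ a => le_min (abs_nonneg _) zero_le_one)
      (fun τ a => min_le_right _ _) (resid_bo hq hc hd he hg h) (bo_int b1) ?_
    filter_upwards [hz] with τ hz ξ
    refine lower_pt gga (fun η => τ * (g τ (ξ + η) - AA q c d e τ ξ))
      ((((hg τ).comp (measurable_const_add ξ)).sub_const _).const_mul τ) _ ?_
    rw [← hz ξ]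
    congr 1; ext η; congr 1; ring
  refine key.congr ?_
  filter_upwards [ev_pos] with τ hτ p
  rw [abs_mul, abs_of_pos hτ]

end

end

section
open MeasureTheory ProbabilityTheory Filter Topology

/-- Trivial weight. -/
def w1 (_ : Unit) : ℝ := 1
lemma w1_one (a) : 1 ≤ w1 a := le_rfl

lemma bo_num {n : ℕ} {X : ℝ → ℝ × ℝ → ℝ} (h : BO ww n X) :
    BO w1 n (fun τ _ => ∫ ξ, X τ ξ ∂gga) := h.num gga gga_int_ww ww_one

lemma bo_num2 {n : ℕ} {X : ℝ → (ℝ × ℝ) × (ℝ × ℝ) → ℝ} (h : BO w2 n X) :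
    BO w1 n (fun τ _ => ∫ ξ, X τ ξ ∂(gga.prod gga)) := h.num _ w2_int w2_one

lemma bo_lift {n : ℕ} {ζ : ℝ → ℝ} (h : BO w1 n (fun τ _ => ζ τ)) :
    BO ww n (fun τ _ => ζ τ) :=
  h.comp (fun _ : ℝ × ℝ => ()) 1 zero_le_one w1_one (fun p => by rw [one_mul]; exact ww_one p)

lemma near_pt {α : Type*} {w : α → ℝ} (hw : ∀ a, 1 ≤ w a) {g T : ℝ → α → ℝ} (ζ : ℝ → ℝ)
    (h1 : BO w 5 (fun τ a => min (τ * |g τ a - T τ a|) 1)) (hT : BO w 0 T)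
    (c : ℝ) (hc : 0 < c) (hc1 : c ≤ 1) :
    BO w 1 (fun τ a => EE (c * τ * (g τ a - ζ τ)) - EE (c * τ * (0 - ζ τ))) := by
  refine (((h1.weaken (m := 1) (by norm_num)).add hw (hT.abs.tau_mul 1 (j := 1) rfl)).const_mul
    3).mono ?_
  filter_upwards [ev_pos] with τ hτ a
  refine (EE_diff _ _).trans ((le_abs_self _).trans' ?_)
  gcongr
  rw [pow_one]
  refine le_trans ?_ (min_split _ _ (by positivity))
  refine min_le_min_right _ ?_
  have e : c * τ * (g τ a - ζ τ) - c * τ * (0 - ζ τ) = c * (τ * g τ a) := by ring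
  rw [e, abs_mul, abs_of_pos hc, abs_mul, abs_of_pos hτ, ← mul_add]
  have h3 : |g τ a| ≤ |g τ a - T τ a| + |T τ a| := by
    have := abs_add_le (g τ a - T τ a) (T τ a)
    simpa using this
  calc c * (τ * |g τ a|) ≤ 1 * (τ * |g τ a|) := by gcongr
    _ ≤ _ := by rw [one_mul]; gcongr

lemma sqrt2_bds : (5 / 4 : ℝ) ≤ √2 ∧ √2 ≤ 2 := by
  constructor
  · exact Real.le_sqrt_of_sq_le (by norm_num)
  · exact Real.sqrt_le_iff.2 (by norm_num)

lemma EE_gap_pos (w : ℝ) (hw : 0 ≤ w) :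
    1 / 4 * Real.exp (-2) * min |w| 1 ≤ √2 * EE w - EE (√2 / 2 * w) := by
  obtain ⟨h1, h2⟩ := sqrt2_bds
  have h3 := EE_lower_pos' 0 w (by simp) hw
  rw [EE_zero, sub_zero, zero_sub, abs_neg] at h3
  have h4 : EE (√2 / 2 * w) ≤ EE w := EE_strictMono.monotone (by nlinarith)
  have h5 : 0 ≤ Real.exp (-2) * min |w| 1 :=
    mul_nonneg (Real.exp_pos _).le (le_min (abs_nonneg _) zero_le_one)
  nlinarith

lemma EE_gap (w : ℝ) : 1 / 4 * Real.exp (-2) * min |w| 1 ≤ |√2 * EE w - EE (√2 / 2 * w)| := by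
  rcases le_total 0 w with h | h
  · exact (EE_gap_pos w h).trans (le_abs_self _)
  · have := EE_gap_pos (-w) (by linarith)
    rw [abs_neg, EE_neg, mul_neg, mul_neg, EE_neg] at this
    refine this.trans (le_trans (le_of_eq ?_) (neg_le_abs _))
    ring

lemma zeta_bdd {g gb T A : ℝ → ℝ × ℝ → ℝ} {ζ : ℝ → ℝ}
    (hg : ∀ τ, Measurable (g τ)) (hgb : ∀ τ, Measurable (gb τ))
    (h1 : BO ww 5 (fun τ a => min (τ * |g τ a - T τ a|) 1)) (hT : BO ww 0 T)
    (h2 : BO ww 5 (fun τ a => min (τ * |gb τ a - A τ a|) 1)) (hA : BO ww 0 A)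
    (heq : ∀ᶠ τ in 𝓝[>] (0 : ℝ), √2 * ∫ ξ, EE (1 * τ * (gb τ ξ - ζ τ)) ∂gga
      = ∫ ξ, EE (√2 / 2 * τ * (g τ ξ - ζ τ)) ∂gga) :
    BO w1 0 (fun τ _ => ζ τ) := by
  obtain ⟨hs1, hs2⟩ := sqrt2_bds
  have n1 := bo_num (near_pt ww_one ζ h2 hA 1 one_pos le_rfl)
  have n2 := bo_num (near_pt ww_one ζ h1 hT (√2 / 2) (by positivity) (by linarith))
  have n3 := (n1.const_mul (√2)).sub w1_one n2
  obtain ⟨C, k, hC, n3⟩ := n3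
  refine ⟨4 * Real.exp 2 * C, 0, by positivity, ?_⟩
  have hev : ∀ᶠ τ in 𝓝[>] (0 : ℝ), τ < 1 / (4 * Real.exp 2 * (C + 1)) := ev_lt (by positivity)
  filter_upwards [n3, heq, ev_pos, hev] with τ n3 heq hτ hlt a
  have i1 := EE_comp_int gga (fun ξ => 1 * τ * (gb τ ξ - ζ τ)) (((hgb τ).sub_const _).const_mul _)
  have i2 := EE_comp_int gga (fun ξ => √2 / 2 * τ * (g τ ξ - ζ τ))
    (((hg τ).sub_const _).const_mul _)
  have n4 := n3 ()
  rw [integral_sub i1 (integrable_const _), integral_sub i2 (integrable_const _)] at n4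
  simp only [integral_const, probReal_univ, one_smul, w1, one_pow, mul_one] at n4
  have e : √2 * (∫ ξ, EE (1 * τ * (gb τ ξ - ζ τ)) ∂gga - EE (1 * τ * (0 - ζ τ)))
      - (∫ ξ, EE (√2 / 2 * τ * (g τ ξ - ζ τ)) ∂gga - EE (√2 / 2 * τ * (0 - ζ τ)))
      = √2 * EE (τ * ζ τ) - EE (√2 / 2 * (τ * ζ τ)) := by
    rw [← heq, show 1 * τ * (0 - ζ τ) = - (τ * ζ τ) by ring,
      show √2 / 2 * τ * (0 - ζ τ) = - (√2 / 2 * (τ * ζ τ)) by ring, EE_neg, EE_neg]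
    ring
  rw [e] at n4
  have h5 := (EE_gap (τ * ζ τ)).trans n4
  have h9 : Real.exp 2 * Real.exp (-2) = 1 := by rw [← Real.exp_add]; simp
  have h10 : min |τ * ζ τ| 1 ≤ 4 * Real.exp 2 * (C * τ) := by
    calc min |τ * ζ τ| 1 = 4 * Real.exp 2 * (1 / 4 * Real.exp (-2) * min |τ * ζ τ| 1) := by
          linear_combination (- min |τ * ζ τ| 1) * h9
      _ ≤ 4 * Real.exp 2 * (C * τ ^ 1) := by gcongr
      _ = _ := by ring
  have h11 : 4 * Real.exp 2 * (C * τ) < 1 := by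
    rw [lt_div_iff₀ (by positivity)] at hlt
    have : 0 < 4 * Real.exp 2 * τ := by positivity
    nlinarith
  have h12 : |τ * ζ τ| ≤ 4 * Real.exp 2 * (C * τ) := by
    rcases min_choice |τ * ζ τ| 1 with h | h
    · rwa [h] at h10
    · rw [h] at h10; linarith
  rw [abs_mul, abs_of_pos hτ] at h12
  simp only [pow_zero, mul_one]
  refine le_of_mul_le_mul_left ?_ hτ
  linarith

lemma PG.scale {F : ℝ × ℝ → ℝ} (h : PG F) : PG (fun p => F (√2 • p)) :=
  ⟨h.meas.comp (by fun_prop), bo_scale h.bo⟩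

lemma main_abs {q c d e : ℝ × ℝ → ℝ} (hq : PG q) (hc : PG c) (hd : PG d) (he : PG e)
    {g gb : ℝ → ℝ × ℝ → ℝ} {ζ : ℝ → ℝ} (tr H D0 : ℝ)
    (oq : ∀ p, q (-p) = q p) (oc : ∀ p, c (-p) = - c p) (oe : ∀ p, e (-p) = - e p)
    (q2 : ∀ p, q (√2 • p) = 2 * q p) (cvq : ∀ p, cv q p = q p + tr / 2)
    (Iq : ∫ p, q p ∂gga = tr / 2) (Iq3 : ∫ p, (q p - tr / 2) ^ 3 ∂gga = H)
    (Iqq : ∫ p : (ℝ × ℝ) × (ℝ × ℝ), (q (p.1 + p.2) - cv q p.1) ^ 3 ∂(gga.prod gga) = 4 * H)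
    (Id : ∫ p, d (√2 • p) ∂gga = D0) (Idd : ∫ p, cv d p ∂gga = D0)
    (hg : ∀ τ, Measurable (g τ)) (hgb : ∀ τ, Measurable (gb τ))
    (h : BO ww 5 (fun τ p => min (τ * |g τ p - TT q c d e τ p|) 1))
    (hz : ∀ᶠ τ in 𝓝[>] (0 : ℝ), ∀ ξ, ∫ η, EE (τ * (g τ (ξ + η) - gb τ ξ)) ∂gga = 0)
    (heq : ∀ᶠ τ in 𝓝[>] (0 : ℝ), √2 * ∫ ξ, EE (1 * τ * (gb τ ξ - ζ τ)) ∂gga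
      = ∫ ξ, EE (√2 / 2 * τ * (g τ (√2 • ξ) - ζ τ)) ∂gga) :
    BO w1 4 (fun τ _ => ζ τ - (tr + τ ^ 2 * (D0 - H))) := by
  obtain ⟨hs1, hs2⟩ := sqrt2_bds
  have hss : √2 * √2 = 2 := Real.mul_self_sqrt (by norm_num)
  have bt : BO ww 0 (fun τ _ => τ) := ((BO.tau ww 1).congr' fun τ a => by simp).weaken (by norm_num)
  have h2 := profile hq hc hd he hg h hz
  have bT := bo_T hq hc hd he
  have bA := bo_A hq hc hd he
  have bK := bo_K hq hc hd he
  have bT2 := bo_scale bT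
  have hg2 : ∀ τ, Measurable (fun ξ => g τ (√2 • ξ)) := fun τ => (hg τ).comp (by fun_prop)
  have bz := zeta_bdd hg2 hgb (bo_scale h) bT2 h2 bA heq
  have bzl := bo_lift bz
  have mA := meas_A hq hc hd he
  have mK := meas_K hq hc hd he
  have mT2 : ∀ τ, Measurable (fun ξ => TT q c d e τ (√2 • ξ)) := fun τ =>
    (meas_TT hq hc hd he τ).comp (by fun_prop)
  have r1 := bo_num (expand_pt ww_one h2 bA bzl 1 one_pos le_rfl)
  have r2 := bo_num (expand_pt ww_one (bo_scale h) bT2 bzl (√2 / 2) (by positivity) (by linarith))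
  have bAz := bA.sub ww_one bzl
  have bTz := bT2.sub ww_one bzl
  have bTB := bo_TB hq hc hd he
  have mTB := meas_TB hq hc hd he
  have iA := bA.integrable gga gga_int_ww mA
  have iK := bK.integrable gga gga_int_ww mK
  have iAz := bAz.integrable gga gga_int_ww (fun τ => (mA τ).sub_const (ζ τ))
  have iAz3 := (bAz.pow 3).integrable gga gga_int_ww (fun τ => ((mA τ).sub_const (ζ τ)).pow_const 3)
  have iTz := bTz.integrable gga gga_int_ww (fun τ => (mT2 τ).sub_const (ζ τ))
  have iTz3 := (bTz.pow 3).integrable gga gga_int_ww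
    (fun τ => ((mT2 τ).sub_const (ζ τ)).pow_const 3)
  have iTB3 := (bTB.pow 3).integrable (gga.prod gga) w2_int (fun τ => (mTB τ).pow_const 3)
  have S1 := bo_num (bAz.pow 3)
  have S2 := bo_num (bTz.pow 3)
  have SK := bo_num2 (bTB.pow 3)
  have key : BO w1 4 (fun τ _ => tr + τ ^ 2 * D0
      - τ ^ 2 * ((1 / 3) * ∫ p : (ℝ × ℝ) × (ℝ × ℝ),
        (TT q c d e τ (p.1 + p.2) - BB q c d e τ p.1) ^ 3 ∂(gga.prod gga)) - ζ τ
      - τ ^ 2 * ((1 / 3) * ∫ p, (AA q c d e τ p - ζ τ) ^ 3 ∂gga)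
      + τ ^ 2 * ((1 / 12) * ∫ p, (TT q c d e τ (√2 • p) - ζ τ) ^ 3 ∂gga)) := by
    refine BO.div_tau (m := 1) ?_
    refine (((r1.const_mul (√2)).sub w1_one r2).const_mul (-√2)).congr ?_
    filter_upwards [heq, iA, iK, iAz, iAz3, iTz, iTz3, iTB3] with τ heq iA iK iAz iAz3 iTz iTz3 iTB3 _
    have e1 := EE_comp_int gga (fun ξ => 1 * τ * (gb τ ξ - ζ τ)) (((hgb τ).sub_const _).const_mul _)
    have e2 := EE_comp_int gga (fun ξ => √2 / 2 * τ * (g τ (√2 • ξ) - ζ τ))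
      (((hg2 τ).sub_const _).const_mul _)
    have eB : Integrable (BB q c d e τ) gga ∧ ∫ p, BB q c d e τ p ∂gga = tr + τ ^ 2 * D0 := by
      have := TT_int hq.cv hc.cv hd.cv he.cv τ
      refine ⟨this.1, ?_⟩
      have h3 := this.2
      have a1 : ∫ p, cv q p ∂gga = tr := by
        simp only [cvq]
        rw [integral_add hq.int (integrable_const _), Iq]; simp
      rw [a1, Idd, odd_int gga gga_neg _ (cv_odd oc), odd_int gga gga_neg _ (cv_odd oe)] at h3
      unfold BB
      rw [h3]; ring
    have eT : Integrable (fun p => TT q c d e τ (√2 • p)) gga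
        ∧ ∫ p, TT q c d e τ (√2 • p) ∂gga = tr + τ ^ 2 * D0 := by
      have := TT_int hq.scale hc.scale hd.scale he.scale τ
      refine ⟨this.1, ?_⟩
      have h3 := this.2
      have a1 : ∫ p, q (√2 • p) ∂gga = tr := by
        simp only [q2]
        rw [integral_const_mul, Iq]; ring
      rw [a1, Id, odd_int gga gga_neg (fun p => c (√2 • p)) (fun p => by rw [smul_neg, oc]),
        odd_int gga gga_neg (fun p => e (√2 • p)) (fun p => by rw [smul_neg, oe])] at h3
      refine Eq.trans h3 ?_
      ring
    have eK : ∫ p, KK q c d e τ p ∂gga = ∫ p : (ℝ × ℝ) × (ℝ × ℝ),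
        (TT q c d e τ (p.1 + p.2) - BB q c d e τ p.1) ^ 3 ∂(gga.prod gga) :=
      (integral_prod _ iTB3).symm
    have eA : ∫ p, AA q c d e τ p ∂gga = tr + τ ^ 2 * D0
        - τ ^ 2 * ((1 / 6) * ∫ p : (ℝ × ℝ) × (ℝ × ℝ),
        (TT q c d e τ (p.1 + p.2) - BB q c d e τ p.1) ^ 3 ∂(gga.prod gga)) := by
      unfold AA
      rw [integral_sub eB.1 ((iK.const_mul _).const_mul _), integral_const_mul, integral_const_mul,
        eK, eB.2]
    have eAz : ∫ p, (AA q c d e τ p - ζ τ) ∂gga = ∫ p, AA q c d e τ p ∂gga - ζ τ := by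
      rw [integral_sub iA (integrable_const _)]; simp
    have eTz : ∫ p, (TT q c d e τ (√2 • p) - ζ τ) ∂gga = tr + τ ^ 2 * D0 - ζ τ := by
      rw [integral_sub eT.1 (integrable_const _), eT.2]; simp
    have iT4 := (iTz.const_mul (√2 / 2 * τ)).sub (iTz3.const_mul ((√2 / 2 * τ) ^ 3 / 6))
    rw [integral_sub e1 (by exact (iAz.const_mul (1 * τ)).sub (iAz3.const_mul ((1 * τ) ^ 3 / 6))),
      integral_sub (iAz.const_mul (1 * τ)) (iAz3.const_mul ((1 * τ) ^ 3 / 6)),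
      integral_sub e2 (by exact iT4),
      integral_sub (iTz.const_mul (√2 / 2 * τ)) (iTz3.const_mul ((√2 / 2 * τ) ^ 3 / 6)),
      integral_const_mul, integral_const_mul, integral_const_mul, integral_const_mul, eAz, eTz, eA,
      ← heq]
    generalize (∫ p : (ℝ × ℝ) × (ℝ × ℝ),
        (TT q c d e τ (p.1 + p.2) - BB q c d e τ p.1) ^ 3 ∂(gga.prod gga)) = IK
    generalize (∫ p, (AA q c d e τ p - ζ τ) ^ 3 ∂gga) = J1
    generalize (∫ p, (TT q c d e τ (√2 • p) - ζ τ) ^ 3 ∂gga) = J2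
    generalize (∫ ξ, EE (1 * τ * (gb τ ξ - ζ τ)) ∂gga) = J3
    have hs4 : √2 * √2 * (√2 * √2) = 4 := by rw [hss]; norm_num
    linear_combination ( - τ * (tr + τ ^ 2 * D0 - τ ^ 2 * ((1 / 6) * IK) - ζ τ)
      + τ ^ 3 / 6 * J1 + τ / 2 * (tr + τ ^ 2 * D0 - ζ τ)) * hss - τ ^ 3 / 48 * J2 * hs4
  -- first approximation
  have z2 : BO w1 2 (fun τ _ => ζ τ - tr) := by
    have a1 := key.weaken (m := 2) (by norm_num)
    have a2 := (BO.const w1 D0).tau_mul 2 (j := 2) rfl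
    have a3 := (SK.const_mul (1 / 3)).tau_mul 2 (j := 2) rfl
    have a4 := (S1.const_mul (1 / 3)).tau_mul 2 (j := 2) rfl
    have a5 := (S2.const_mul (1 / 12)).tau_mul 2 (j := 2) rfl
    refine ((((a1.neg.add w1_one a2).sub w1_one a3).sub w1_one a4).add w1_one a5).congr'
      fun τ a => ?_
    ring
  have z2l := bo_lift z2
  -- cubes
  have c1 : BO w1 2 (fun τ _ => ∫ p, (AA q c d e τ p - ζ τ) ^ 3 ∂gga - ∫ p, (q p - tr / 2) ^ 3 ∂gga) := by
    refine cube_lemma gga gga_neg ww_one gga_int_ww (fun τ p => AA q c d e τ p - ζ τ)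
      (fun p => q p - tr / 2) (cv c) (fun τ => (mA τ).sub_const _) (hq.meas.sub_const _) hc.cv.meas
      (hq.bo.sub ww_one (BO.const ww _)) hc.cv.bo (fun a => by simp only [oq]) (cv_odd oc) ?_
    have a1 := (bo_TT ww_one (fun p => p) hq.cv.bo hc.cv.bo hd.cv.bo he.cv.bo).2
    have a2 := (bK.const_mul (1 / 6)).tau_mul 2 (j := 2) rfl
    refine ((a1.sub ww_one a2).sub ww_one z2l).congr' fun τ p => ?_
    rw [cvq]
    unfold AA BB
    ring
  have c2 : BO w1 2 (fun τ _ => ∫ p, (TT q c d e τ (√2 • p) - ζ τ) ^ 3 ∂gga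
      - ∫ p, (2 * q p - tr) ^ 3 ∂gga) := by
    refine cube_lemma gga gga_neg ww_one gga_int_ww (fun τ p => TT q c d e τ (√2 • p) - ζ τ)
      (fun p => 2 * q p - tr) (fun p => c (√2 • p)) (fun τ => (mT2 τ).sub_const _)
      ((hq.meas.const_mul 2).sub_const _) hc.scale.meas
      ((hq.bo.const_mul 2).sub ww_one (BO.const ww _)) hc.scale.bo (fun a => by simp only [oq])
      (fun p => by rw [smul_neg, oc]) ?_
    have a1 := (bo_TT ww_one (fun p => √2 • p) hq.scale.bo hc.scale.bo hd.scale.bo he.scale.bo).2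
    refine (a1.sub ww_one z2l).congr' fun τ p => ?_
    rw [← q2]
    ring
  have c3 : BO w1 2 (fun τ _ => ∫ p : (ℝ × ℝ) × (ℝ × ℝ),
        (TT q c d e τ (p.1 + p.2) - BB q c d e τ p.1) ^ 3 ∂(gga.prod gga)
      - ∫ p : (ℝ × ℝ) × (ℝ × ℝ), (q (p.1 + p.2) - cv q p.1) ^ 3 ∂(gga.prod gga)) := by
    refine cube_lemma (gga.prod gga) gga2_neg w2_one w2_int
      (fun τ p => TT q c d e τ (p.1 + p.2) - BB q c d e τ p.1)
      (fun p => q (p.1 + p.2) - cv q p.1) (fun p => c (p.1 + p.2) - cv c p.1) mTB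
      ((hq.meas.comp (by fun_prop)).sub (hq.cv.meas.comp measurable_fst))
      ((hc.meas.comp (by fun_prop)).sub (hc.cv.meas.comp measurable_fst))
      ((bo_shift hq.bo).sub w2_one (bo_fst hq.cv.bo))
      ((bo_shift hc.bo).sub w2_one (bo_fst hc.cv.bo))
      (fun p => ?_) (fun p => ?_) ?_
    · simp only [cvq, Prod.fst_neg, Prod.snd_neg, ← neg_add, oq]
    · simp only [Prod.fst_neg, Prod.snd_neg, ← neg_add, oc, cv_odd oc]; ring
    · have a1 := bo_shift (bo_TT ww_one (fun p => p) hq.bo hc.bo hd.bo he.bo).2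
      have a2 := bo_fst (bo_TT ww_one (fun p => p) hq.cv.bo hc.cv.bo hd.cv.bo he.cv.bo).2
      refine (a1.sub w2_one a2).congr' fun τ p => ?_
      unfold BB
      ring
  have I8 : ∫ p, (2 * q p - tr) ^ 3 ∂gga = 8 * H := by
    rw [← Iq3, ← integral_const_mul]
    congr 1; ext p; ring
  rw [Iq3] at c1
  rw [I8] at c2
  rw [Iqq] at c3
  have b1 := (c3.const_mul (1 / 3)).tau_mul 2 (j := 4) rfl
  have b2 := (c1.const_mul (1 / 3)).tau_mul 2 (j := 4) rfl
  have b3 := (c2.const_mul (1 / 12)).tau_mul 2 (j := 4) rfl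
  refine (((key.neg.sub w1_one b1).sub w1_one b2).add w1_one b3).congr' fun τ a => ?_
  ring

end

section
open MeasureTheory ProbabilityTheory Filter Topology

namespace PG
variable {F G : ℝ × ℝ → ℝ}
lemma add (hF : PG F) (hG : PG G) : PG (fun p => F p + G p) :=
  ⟨hF.meas.add hG.meas, hF.bo.add ww_one hG.bo⟩
lemma mul (hF : PG F) (hG : PG G) : PG (fun p => F p * G p) :=
  ⟨hF.meas.mul hG.meas, hF.bo.mul' hG.bo rfl⟩
lemma pow (hF : PG F) (j : ℕ) : PG (fun p => F p ^ j) :=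
  ⟨hF.meas.pow_const j, hF.bo.pow j⟩
lemma cst (c : ℝ) : PG (fun _ => c) := ⟨measurable_const, BO.const ww c⟩
lemma cmul (c : ℝ) (hF : PG F) : PG (fun p => c * F p) := (cst c).mul hF
lemma fst : PG (fun p => p.1) :=
  ⟨measurable_fst, 1, 1, zero_le_one, Eventually.of_forall fun τ p => by
    have := abs_nonneg p.2; simp [ww]; linarith⟩
lemma snd : PG (fun p => p.2) :=
  ⟨measurable_snd, 1, 1, zero_le_one, Eventually.of_forall fun τ p => by
    have := abs_nonneg p.1; simp [ww]; linarith⟩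
lemma mono (a : ℝ) (i j : ℕ) : PG (fun p => a * (p.1 ^ i * p.2 ^ j)) :=
  cmul a ((fst.pow i).mul (snd.pow j))
lemma of_eq (hF : PG F) (h : ∀ p, G p = F p) : PG G := by
  rwa [show G = F from funext h]
lemma iter (hF : PG F) : ∫ p, F p ∂gga = ∫ x, ∫ y, F (x, y) ∂gmu ∂gmu :=
  integral_prod F hF.int
end PG

lemma pg_Q2 (a b c : ℝ) : PG (Q2 a b c) :=
  (((PG.mono (a / 2) 2 0).add (PG.mono b 1 1)).add (PG.mono (c / 2) 0 2)).of_eq fun p => by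
    unfold Q2; ring

lemma pg_Q3 (a b c d : ℝ) : PG (Q3 a b c d) :=
  ((((PG.mono a 3 0).add (PG.mono b 2 1)).add (PG.mono c 1 2)).add (PG.mono d 0 3)).of_eq fun p => by
    unfold Q3; ring

lemma pg_Q4 (a b c d e : ℝ) : PG (Q4 a b c d e) :=
  (((((PG.mono a 4 0).add (PG.mono b 3 1)).add (PG.mono c 2 2)).add (PG.mono d 1 3)).add
    (PG.mono e 0 4)).of_eq fun p => by
    unfold Q4; ring

lemma pg_Q5 (a b c d e k : ℝ) : PG (Q5 a b c d e k) :=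
  ((((((PG.mono a 5 0).add (PG.mono b 4 1)).add (PG.mono c 3 2)).add (PG.mono d 2 3)).add
    (PG.mono e 1 4)).add (PG.mono k 0 5)).of_eq fun p => by
    unfold Q5; ring

lemma gm6 {F : ℝ → ℝ} (a0 a1 a2 a3 a4 a5 a6 : ℝ)
    (h : ∀ x, F x = a0 + a1 * x + a2 * x ^ 2 + a3 * x ^ 3 + a4 * x ^ 4 + a5 * x ^ 5 + a6 * x ^ 6) :
    ∫ x, F x ∂gmu = a0 + a2 + 3 * a4 + 15 * a6 := by
  rw [← poly6 a0 a1 a2 a3 a4 a5 a6]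
  congr 1; ext x; exact h x

lemma int_Q2 (a b c : ℝ) : ∫ p, Q2 a b c p ∂gga = (a + c) / 2 := by
  rw [(pg_Q2 a b c).iter]
  have : ∀ x : ℝ, ∫ y, Q2 a b c (x, y) ∂gmu = a * x ^ 2 / 2 + c / 2 := fun x => by
    rw [gm6 (a * x ^ 2 / 2) (b * x) (c / 2) 0 0 0 0 (fun y => by simp only [Q2]; ring)]; ring
  simp only [this]
  rw [gm6 (c / 2) 0 (a / 2) 0 0 0 0 (fun y => by ring)]; ring

lemma cv_Q2 (a b c : ℝ) (p : ℝ × ℝ) : cv (Q2 a b c) p = Q2 a b c p + (a + c) / 2 := by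
  have h : PG (fun η => Q2 a b c (p + η)) :=
    (((pg_Q2 a b c).add (PG.cst (Q2 a b c p))).add ((PG.mono (a * p.1 + b * p.2) 1 0).add
      (PG.mono (b * p.1 + c * p.2) 0 1))).of_eq fun η => by
        simp only [Q2, Prod.fst_add, Prod.snd_add]; ring
  unfold cv
  rw [h.iter]
  have : ∀ u : ℝ, ∫ v, Q2 a b c (p + (u, v)) ∂gmu = Q2 a b c (p.1 + u, p.2) + c / 2 := fun u => by
    rw [gm6 (Q2 a b c (p.1 + u, p.2)) (b * (p.1 + u) + c * p.2) (c / 2) 0 0 0 0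
      (fun y => by simp only [Q2, Prod.fst_add, Prod.snd_add]; ring)]; ring
  simp only [this]
  rw [gm6 (Q2 a b c p + c / 2) (a * p.1 + b * p.2) (a / 2) 0 0 0 0
    (fun y => by simp only [Q2]; ring)]; ring

lemma int_cube (P Q R : ℝ) : ∫ v, (P + Q * v + R * v ^ 2) ^ 3 ∂gmu
    = P ^ 3 + 3 * P ^ 2 * R + 3 * P * Q ^ 2 + 9 * P * R ^ 2 + 9 * Q ^ 2 * R + 15 * R ^ 3 := by
  rw [gm6 (P ^ 3) (3 * P ^ 2 * Q) (3 * P ^ 2 * R + 3 * P * Q ^ 2) (6 * P * Q * R + Q ^ 3)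
    (3 * P * R ^ 2 + 3 * Q ^ 2 * R) (3 * Q * R ^ 2) (R ^ 3) (fun y => by ring)]
  ring

lemma int_cube2 (α b R L M β : ℝ) :
    ∫ p : ℝ × ℝ, (α * p.1 ^ 2 + b * p.1 * p.2 + R * p.2 ^ 2 + L * p.1 + M * p.2 + β) ^ 3 ∂gga
    = (β ^ 3 + 3 * β ^ 2 * R + 9 * β * R ^ 2 + 15 * R ^ 3
      + 3 * α * β ^ 2 + 6 * R * α * β + 3 * β * b ^ 2 + 9 * α * R ^ 2 + 9 * b ^ 2 * R
      + 9 * α ^ 2 * β + 9 * R * α ^ 2 + 9 * α * b ^ 2 + 15 * α ^ 3)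
      + (3 * β + 3 * R + 9 * α) * L ^ 2 + 6 * b * (L * M) + (3 * β + 9 * R + 3 * α) * M ^ 2 := by
  have h : PG (fun p : ℝ × ℝ =>
      (α * p.1 ^ 2 + b * p.1 * p.2 + R * p.2 ^ 2 + L * p.1 + M * p.2 + β) ^ 3) :=
    ((((((PG.mono α 2 0).add (PG.mono b 1 1)).add (PG.mono R 0 2)).add (PG.mono L 1 0)).add
      (PG.mono M 0 1)).add (PG.cst β)).pow 3 |>.of_eq fun p => by ring
  rw [h.iter]
  have : ∀ u : ℝ, ∫ v, (α * u ^ 2 + b * u * v + R * v ^ 2 + L * u + M * v + β) ^ 3 ∂gmu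
      = ∫ v, ((α * u ^ 2 + L * u + β) + (b * u + M) * v + R * v ^ 2) ^ 3 ∂gmu :=
    fun u => by congr 1; ext v; ring
  simp only [this, int_cube]
  rw [gm6 (β ^ 3 + 3 * β ^ 2 * R + 3 * β * M ^ 2 + 9 * β * R ^ 2 + 9 * M ^ 2 * R + 15 * R ^ 3)
    (3 * β ^ 2 * L + 6 * R * β * L + 3 * (L * M ^ 2 + 2 * β * b * M) + 9 * L * R ^ 2 + 18 * b * M * R)
    (3 * α * β ^ 2 + 3 * β * L ^ 2 + 3 * R * (L ^ 2 + 2 * α * β)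
      + 3 * (α * M ^ 2 + 2 * L * b * M + β * b ^ 2) + 9 * α * R ^ 2 + 9 * b ^ 2 * R)
    (L ^ 3 + 6 * α * β * L + 6 * α * L * R + 3 * (2 * α * b * M + L * b ^ 2))
    (3 * α ^ 2 * β + 3 * α * L ^ 2 + 3 * R * α ^ 2 + 3 * α * b ^ 2)
    (3 * α ^ 2 * L) (α ^ 3) (fun y => by ring)]
  ring

lemma int_Q2_cube (a b c : ℝ) : ∫ p, (Q2 a b c p - (a + c) / 2) ^ 3 ∂gga
    = a ^ 3 + 3 * a * b ^ 2 + 3 * c * b ^ 2 + c ^ 3 := by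
  have := int_cube2 (a / 2) b (c / 2) 0 0 (-(a + c) / 2)
  calc _ = _ := by
        congr 1; ext p
        show _ = (a / 2 * p.1 ^ 2 + b * p.1 * p.2 + c / 2 * p.2 ^ 2 + 0 * p.1 + 0 * p.2
          + -(a + c) / 2) ^ 3
        unfold Q2; ring
    _ = _ := this
    _ = _ := by ring

lemma int_LM (a b c k0 k1 k2 k3 : ℝ) : ∫ p : ℝ × ℝ, (k0 + k1 * (a * p.1 + b * p.2) ^ 2
      + k2 * ((a * p.1 + b * p.2) * (b * p.1 + c * p.2)) + k3 * (b * p.1 + c * p.2) ^ 2) ∂gga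
    = k0 + k1 * (a ^ 2 + b ^ 2) + k2 * (a * b + b * c) + k3 * (b ^ 2 + c ^ 2) := by
  have h : PG (fun p : ℝ × ℝ => (k0 + k1 * (a * p.1 + b * p.2) ^ 2
      + k2 * ((a * p.1 + b * p.2) * (b * p.1 + c * p.2)) + k3 * (b * p.1 + c * p.2) ^ 2)) := by
    have l1 := (PG.mono a 1 0).add (PG.mono b 0 1)
    have l2 := (PG.mono b 1 0).add (PG.mono c 0 1)
    exact ((((PG.cst k0).add ((l1.pow 2).cmul k1)).add ((l1.mul l2).cmul k2)).add
      ((l2.pow 2).cmul k3)).of_eq fun p => by ring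
  rw [h.iter]
  have : ∀ x : ℝ, ∫ y, (k0 + k1 * (a * x + b * y) ^ 2
      + k2 * ((a * x + b * y) * (b * x + c * y)) + k3 * (b * x + c * y) ^ 2) ∂gmu
      = k0 + (k1 * a ^ 2 + k2 * (a * b) + k3 * b ^ 2) * x ^ 2
        + (k1 * b ^ 2 + k2 * (b * c) + k3 * c ^ 2) := fun x => by
    rw [gm6 (k0 + (k1 * a ^ 2 + k2 * (a * b) + k3 * b ^ 2) * x ^ 2)
      (2 * k1 * a * b * x + k2 * x * (a * c + b ^ 2) + 2 * k3 * b * c * x)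
      (k1 * b ^ 2 + k2 * (b * c) + k3 * c ^ 2) 0 0 0 0 (fun y => by ring)]; ring
  simp only [this]
  rw [gm6 (k0 + (k1 * b ^ 2 + k2 * (b * c) + k3 * c ^ 2)) 0
    (k1 * a ^ 2 + k2 * (a * b) + k3 * b ^ 2) 0 0 0 0 (fun y => by ring)]
  ring

lemma int_Q2_cube2 (a b c : ℝ) : ∫ p : (ℝ × ℝ) × (ℝ × ℝ),
    (Q2 a b c (p.1 + p.2) - cv (Q2 a b c) p.1) ^ 3 ∂(gga.prod gga)
    = 4 * (a ^ 3 + 3 * a * b ^ 2 + 3 * c * b ^ 2 + c ^ 3) := by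
  have h := pg_Q2 a b c
  have hi : Integrable (fun p : (ℝ × ℝ) × (ℝ × ℝ) =>
      (Q2 a b c (p.1 + p.2) - cv (Q2 a b c) p.1) ^ 3) (gga.prod gga) :=
    (((bo_shift h.bo).sub w2_one (bo_fst h.cv.bo)).pow 3).integrable_const _ w2_int
      (((h.meas.comp (by fun_prop)).sub (h.cv.meas.comp measurable_fst)).pow_const 3)
  rw [integral_prod _ hi]
  have : ∀ p : ℝ × ℝ, ∫ η, (Q2 a b c (p + η) - cv (Q2 a b c) p) ^ 3 ∂gga
      = ∫ η : ℝ × ℝ, ((a / 2) * η.1 ^ 2 + b * η.1 * η.2 + (c / 2) * η.2 ^ 2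
        + (a * p.1 + b * p.2) * η.1 + (b * p.1 + c * p.2) * η.2 + -(a + c) / 2) ^ 3 ∂gga := fun p => by
    congr 1; ext η
    rw [cv_Q2]
    simp only [Q2, Prod.fst_add, Prod.snd_add]; ring
  simp only [this, int_cube2]
  rw [int_LM]
  ring

lemma int_Q4 (a b c d e : ℝ) : ∫ p, Q4 a b c d e p ∂gga = 3 * a + c + 3 * e := by
  rw [(pg_Q4 a b c d e).iter]
  have : ∀ x : ℝ, ∫ y, Q4 a b c d e (x, y) ∂gmu = a * x ^ 4 + c * x ^ 2 + 3 * e := fun x => by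
    rw [gm6 (a * x ^ 4) (b * x ^ 3) (c * x ^ 2) (d * x) e 0 0 (fun y => by simp only [Q4]; ring)]
    ring
  simp only [this]
  rw [gm6 (3 * e) 0 c 0 a 0 0 (fun y => by ring)]; ring

lemma cv_Q4 (a b c d e : ℝ) (p : ℝ × ℝ) : cv (Q4 a b c d e) p = Q4 a b c d e p
    + Q2 (2 * c + 12 * a) (3 * (b + d)) (12 * e + 2 * c) p + 3 * a + c + 3 * e := by
  have hs := (pg_Q4 a b c d e).int_shift p
  unfold cv
  have : ∫ η, Q4 a b c d e (p + η) ∂gga = ∫ u, ∫ v, Q4 a b c d e (p + (u, v)) ∂gmu ∂gmu :=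
    integral_prod _ hs
  rw [this]
  have : ∀ u : ℝ, ∫ v, Q4 a b c d e (p + (u, v)) ∂gmu = Q4 a b c d e (p.1 + u, p.2)
      + c * (p.1 + u) ^ 2 + 3 * d * (p.1 + u) * p.2 + 6 * e * p.2 ^ 2 + 3 * e := fun u => by
    rw [gm6 (Q4 a b c d e (p.1 + u, p.2)) (b * (p.1 + u) ^ 3 + 2 * c * (p.1 + u) ^ 2 * p.2
      + 3 * d * (p.1 + u) * p.2 ^ 2 + 4 * e * p.2 ^ 3)
      (c * (p.1 + u) ^ 2 + 3 * d * (p.1 + u) * p.2 + 6 * e * p.2 ^ 2) (d * (p.1 + u) + 4 * e * p.2) e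
      0 0 (fun y => by simp only [Q4, Prod.fst_add, Prod.snd_add]; ring)]; ring
  simp only [this]
  rw [gm6 (Q4 a b c d e p + c * p.1 ^ 2 + 3 * d * p.1 * p.2 + 6 * e * p.2 ^ 2 + 3 * e)
    (4 * a * p.1 ^ 3 + 3 * b * p.1 ^ 2 * p.2 + 2 * c * p.1 * p.2 ^ 2 + d * p.2 ^ 3 + 2 * c * p.1
      + 3 * d * p.2) (6 * a * p.1 ^ 2 + 3 * b * p.1 * p.2 + c * p.2 ^ 2 + c)
    (4 * a * p.1 + b * p.2) a 0 0
    (fun y => by simp only [Q4]; ring)]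
  simp only [Q2, Q4]
  ring

lemma int_cv_Q4 (a b c d e : ℝ) : ∫ p, cv (Q4 a b c d e) p ∂gga = 4 * (3 * a + c + 3 * e) := by
  simp only [cv_Q4]
  have i1 := (pg_Q4 a b c d e).int
  have i2 := (pg_Q2 (2 * c + 12 * a) (3 * (b + d)) (12 * e + 2 * c)).int
  have e1 : ∀ p, Q4 a b c d e p
    + Q2 (2 * c + 12 * a) (3 * (b + d)) (12 * e + 2 * c) p + 3 * a + c + 3 * e
    = Q4 a b c d e p + (Q2 (2 * c + 12 * a) (3 * (b + d)) (12 * e + 2 * c) p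
      + (3 * a + c + 3 * e)) := fun p => by ring
  simp only [e1]
  rw [integral_add i1 (by exact i2.add (integrable_const _)), integral_add i2 (integrable_const _),
    int_Q4, int_Q2]
  simp
  ring

end

open MeasureTheory ProbabilityTheory Filter Topology

lemma F1 (f : ℝ → ℝ → ℝ) (q c d e : ℝ × ℝ → ℝ) (M : ℝ) (hM : 0 ≤ M)
    (hh : ∀ p : ℝ × ℝ, |p.1| + |p.2| ≤ 1 → |f p.1 p.2 - (q p + c p + d p + e p)|
      ≤ M * (|p.1| + |p.2|) ^ 6)
    (q1 : ∀ (τ : ℝ) (p : ℝ × ℝ), q (τ * p.1, τ * p.2) = τ ^ 2 * q p)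
    (c1 : ∀ (τ : ℝ) (p : ℝ × ℝ), c (τ * p.1, τ * p.2) = τ ^ 3 * c p)
    (d1 : ∀ (τ : ℝ) (p : ℝ × ℝ), d (τ * p.1, τ * p.2) = τ ^ 4 * d p)
    (e1 : ∀ (τ : ℝ) (p : ℝ × ℝ), e (τ * p.1, τ * p.2) = τ ^ 5 * e p) :
    BO ww 5 (fun τ p => min (τ * |f (τ * p.1) (τ * p.2) / τ ^ 2 - TT q c d e τ p|) 1) := by
  refine ⟨M + 1, 6, by positivity, ?_⟩
  filter_upwards [ev_pos] with τ hτ p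
  have hw := ww_one p
  have hs : |p.1| + |p.2| ≤ ww p := by unfold ww; linarith
  have hs0 : 0 ≤ |p.1| + |p.2| := by positivity
  rw [abs_of_nonneg (le_min (by positivity) zero_le_one)]
  have ht : |τ * p.1| + |τ * p.2| = τ * (|p.1| + |p.2|) := by
    rw [abs_mul, abs_mul, abs_of_pos hτ]; ring
  rcases le_total (τ * (|p.1| + |p.2|)) 1 with h | h
  · refine (min_le_left _ _).trans ?_
    have h1 := hh (τ * p.1, τ * p.2) (by simpa only [ht] using h)
    rw [q1, c1, d1, e1] at h1
    simp only [ht] at h1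
    have e : τ * |f (τ * p.1) (τ * p.2) / τ ^ 2 - TT q c d e τ p|
        = |f (τ * p.1) (τ * p.2) - (τ ^ 2 * q p + τ ^ 3 * c p + τ ^ 4 * d p + τ ^ 5 * e p)| / τ := by
      rw [← abs_of_pos hτ, ← abs_mul, ← abs_div, abs_of_pos hτ]
      congr 1
      unfold TT
      field_simp
    rw [e, div_le_iff₀ hτ]
    calc _ ≤ _ := h1
      _ = M * τ ^ 6 * (|p.1| + |p.2|) ^ 6 := by ring
      _ ≤ (M + 1) * τ ^ 6 * ww p ^ 6 := by gcongr; linarith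
      _ = _ := by ring
  · refine (min_le_right _ _).trans ?_
    calc (1 : ℝ) ≤ (τ * (|p.1| + |p.2|)) ^ 5 := one_le_pow₀ h
      _ = 1 * τ ^ 5 * (|p.1| + |p.2|) ^ 5 := by ring
      _ ≤ 1 * τ ^ 5 * ww p ^ 5 := by gcongr
      _ ≤ (M + 1) * τ ^ 5 * ww p ^ 6 := by
        gcongr
        · linarith
        · norm_num

lemma final_prep (f : ℝ → ℝ → ℝ)
    (hf : ContDiff ℝ (⊤ : ℕ∞) (fun p : ℝ × ℝ => f p.1 p.2))
    (h0 : f 0 0 = 0) (hfx : pdx f 0 0 = 0) (hfy : pdy f 0 0 = 0)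
    (S : Set (ℝ × ℝ × ℝ)) (hS : S = {p : ℝ × ℝ × ℝ | p.2.2 ≤ f p.1 p.2.1})
    (Sb : ℝ → Set (ℝ × ℝ × ℝ))
    (hSb : ∀ t : ℝ, Sb t = {p : ℝ × ℝ × ℝ | 1 / 2 ≤ conv3 (t / 2) (Set.indicator S 1) p})
    (ε : ℝ) (hε : 0 < ε) (z : ℝ → ℝ)
    (hzeq : ∀ t ∈ Set.Ioo (0 : ℝ) ε,
      Real.sqrt 2 * conv3 (t / 2) (Set.indicator (Sb t) 1) (0, 0, z t)
        - conv3 t (Set.indicator S 1) (0, 0, z t) = (Real.sqrt 2 - 1) / 2)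
    (a b c : ℝ) (ha : a = pdx (pdx f) 0 0) (hb : b = pdx (pdy f) 0 0) (hc : c = pdy (pdy f) 0 0) :
    BO w1 4 (fun τ _ => z (τ ^ 2) / τ ^ 2 - ((a + c) + τ ^ 2 * (
      4 * (3 * (pdx (pdx (pdx (pdx f))) 0 0 / 24) + pdx (pdx (pdy (pdy f))) 0 0 / 4
        + 3 * (pdy (pdy (pdy (pdy f))) 0 0 / 24))
      - (a ^ 3 + 3 * a * b ^ 2 + 3 * c * b ^ 2 + c ^ 3)))) := by
  obtain ⟨c0, c1, c2, c3, d1, d3, e0, e1, e2, e3, e4, e5, M, hM, hT⟩ := taylor3 f hf h0 hfx hfy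
  rw [← ha, ← hb, ← hc] at hT
  generalize pdx (pdx (pdx (pdx f))) 0 0 / 24 = d0 at *
  generalize pdx (pdx (pdy (pdy f))) 0 0 / 4 = d2 at *
  generalize pdy (pdy (pdy (pdy f))) 0 0 / 24 = d4 at *
  have hfm : Measurable (fun p : ℝ × ℝ => f p.1 p.2) := hf.continuous.measurable
  have hs2 : √2 * √2 = 2 := Real.mul_self_sqrt (by norm_num)
  have hs0 : 0 < √2 := by positivity
  have hch : ∀ τ : ℝ, ∃ fb : ℝ → ℝ → ℝ, Measurable (fun p : ℝ × ℝ => fb p.1 p.2) ∧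
      (0 < τ → τ ^ 2 < ε →
      (∀ x y, ∫ ξ, EE ((f (x + τ * ξ.1) (y + τ * ξ.2) - fb x y) / τ) ∂gga = 0) ∧
      √2 * ∫ ξ, EE ((fb (τ * ξ.1) (τ * ξ.2) - z (τ ^ 2)) / τ) ∂gga
        = ∫ ξ, EE ((f (√2 * τ * ξ.1) (√2 * τ * ξ.2) - z (τ ^ 2)) / (√2 * τ)) ∂gga) := by
    intro τ
    by_cases h : 0 < τ ∧ τ ^ 2 < ε
    · have hp : 0 < τ ^ 2 := by have := h.1; positivity
      obtain ⟨fb, h1, h2⟩ := reform f hfm S hS (Sb (τ ^ 2)) (τ ^ 2) hp (hSb _) (z (τ ^ 2)) τ h.1 rfl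
        (hzeq _ ⟨hp, h.2⟩)
      exact ⟨fb, h1, fun _ _ => h2⟩
    · exact ⟨fun _ _ => 0, measurable_const, fun h1 h2 => absurd ⟨h1, h2⟩ h⟩
  choose fb hfb1 hfb2 using hch
  have hev : ∀ᶠ τ in 𝓝[>] (0 : ℝ), 0 < τ ∧ τ ^ 2 < ε := by
    filter_upwards [ev_pos, ev_lt hε, ev_lt one_pos] with τ h1 h2 h3
    exact ⟨h1, by nlinarith⟩
  refine main_abs (pg_Q2 a b c) (pg_Q3 c0 c1 c2 c3) (pg_Q4 d0 d1 d2 d3 d4)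
    (pg_Q5 e0 e1 e2 e3 e4 e5) (g := fun τ p => f (τ * p.1) (τ * p.2) / τ ^ 2)
    (gb := fun τ p => fb τ (τ * p.1) (τ * p.2) / τ ^ 2) (a + c) _ _
    (fun p => by simp [Q2]) (fun p => by simp only [Q3, Prod.fst_neg, Prod.snd_neg]; ring)
    (fun p => by simp only [Q5, Prod.fst_neg, Prod.snd_neg]; ring)
    (fun p => ?_) (cv_Q2 a b c) (int_Q2 a b c)
    (int_Q2_cube a b c) (int_Q2_cube2 a b c) ?_ (int_cv_Q4 d0 d1 d2 d3 d4) (fun τ => ?_) (fun τ => ?_)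
    ?_ ?_ ?_
  · simp only [Q2, Prod.smul_fst, Prod.smul_snd, smul_eq_mul]
    linear_combination (a * p.1 ^ 2 + 2 * b * p.1 * p.2 + c * p.2 ^ 2) / 2 * hs2
  · have : ∀ p : ℝ × ℝ, Q4 d0 d1 d2 d3 d4 (√2 • p) = 4 * Q4 d0 d1 d2 d3 d4 p := fun p => by
      have hs4 : √2 * √2 * (√2 * √2) = 4 := by rw [hs2]; norm_num
      simp only [Q4, Prod.smul_fst, Prod.smul_snd, smul_eq_mul]
      linear_combination (d0 * p.1 ^ 4 + d1 * p.1 ^ 3 * p.2 + d2 * p.1 ^ 2 * p.2 ^ 2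
        + d3 * p.1 * p.2 ^ 3 + d4 * p.2 ^ 4) * hs4
    simp only [this]
    rw [integral_const_mul, int_Q4]
  · exact (hfm.comp (by fun_prop : Measurable (fun p : ℝ × ℝ => (τ * p.1, τ * p.2)))).div_const _
  · exact ((hfb1 τ).comp (by fun_prop : Measurable (fun p : ℝ × ℝ => (τ * p.1, τ * p.2)))).div_const _
  · refine F1 f _ _ _ _ M hM hT (fun τ p => ?_) (fun τ p => ?_) (fun τ p => ?_) (fun τ p => ?_)
    · simp only [Q2]; ring
    · simp only [Q3]; ring
    · simp only [Q4]; ring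
    · simp only [Q5]; ring
  · filter_upwards [hev] with τ hτ ξ
    have h := (hfb2 τ hτ.1 hτ.2).1 (τ * ξ.1) (τ * ξ.2)
    rw [← h]
    have hp := hτ.1
    congr 1; ext η
    congr 1
    simp only [Prod.fst_add, Prod.snd_add, mul_add]
    field_simp
  · filter_upwards [hev] with τ hτ
    have h := (hfb2 τ hτ.1 hτ.2).2
    have hp := hτ.1
    calc _ = √2 * ∫ ξ, EE ((fb τ (τ * ξ.1) (τ * ξ.2) - z (τ ^ 2)) / τ) ∂gga := by
          congr 2; ext ξ; congr 1; field_simp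
      _ = _ := h
      _ = _ := by
          congr 1; ext ξ; congr 1
          simp only [Prod.smul_fst, Prod.smul_snd, smul_eq_mul]
          rw [show τ * (√2 * ξ.1) = √2 * τ * ξ.1 by ring, show τ * (√2 * ξ.2) = √2 * τ * ξ.2 by ring]
          rw [div_eq_iff (by positivity)]
          field_simp
          linear_combination (-(f (√2 * τ * ξ.1) (√2 * τ * ξ.2) - z (τ ^ 2))) * hs2

/-- Second order consistency of the natural two-kernel extrapolation scheme: with
`Σ̄_t = {G_{t/2} * 1_Σ ≥ 1/2}`, the level set
`(√2 G_{t/2} * 1_{Σ̄_t} − G_t * 1_Σ)(0,0,z(t)) = (√2 − 1)/2` is attained at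
`z(t) = t (f_xx + f_yy) + t² ((1/2)(f_xxxx + 2 f_xxyy + f_yyyy)
  − (f_xx³ + 3 f_xx f_xy² + 3 f_yy f_xy² + f_yy³)) + O(t³)`,
the second order expansion of motion by mean curvature. -/
theorem two_kernel_extrapolation_second_order (f : ℝ → ℝ → ℝ)
    (hf : ContDiff ℝ (⊤ : ℕ∞) (fun p : ℝ × ℝ => f p.1 p.2))
    (h0 : f 0 0 = 0) (hfx : pdx f 0 0 = 0) (hfy : pdy f 0 0 = 0)
    (S : Set (ℝ × ℝ × ℝ)) (hS : S = {p : ℝ × ℝ × ℝ | p.2.2 ≤ f p.1 p.2.1})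
    (Sb : ℝ → Set (ℝ × ℝ × ℝ))
    (hSb : ∀ t : ℝ, Sb t = {p : ℝ × ℝ × ℝ | 1 / 2 ≤ conv3 (t / 2) (Set.indicator S 1) p})
    (ε : ℝ) (hε : 0 < ε) (z : ℝ → ℝ)
    (hz0 : Filter.Tendsto z (nhdsWithin 0 (Set.Ioi 0)) (nhds 0))
    (hzeq : ∀ t ∈ Set.Ioo (0 : ℝ) ε,
      Real.sqrt 2 * conv3 (t / 2) (Set.indicator (Sb t) 1) (0, 0, z t)
        - conv3 t (Set.indicator S 1) (0, 0, z t) = (Real.sqrt 2 - 1) / 2) :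
    let fxx := pdx (pdx f) 0 0
    let fyy := pdy (pdy f) 0 0
    let fxy := pdx (fun a b => pdy f a b) 0 0
    let fxxxx := pdx (pdx (pdx (pdx f))) 0 0
    let fxxyy := pdx (pdx (pdy (pdy f))) 0 0
    let fyyyy := pdy (pdy (pdy (pdy f))) 0 0
    ∃ C ε' : ℝ, 0 < ε' ∧ ∀ t ∈ Set.Ioo (0 : ℝ) ε',
      |z t - (t * (fxx + fyy)
        + t ^ 2 * ((1 / 2) * (fxxxx + 2 * fxxyy + fyyyy)
          - (fxx ^ 3 + 3 * fxx * fxy ^ 2 + 3 * fyy * fxy ^ 2 + fyy ^ 3)))|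
        ≤ C * t ^ 3 := by
  intro fxx fyy fxy fxxxx fxxyy fyyyy
  obtain ⟨C, k, hC, h⟩ := final_prep f hf h0 hfx hfy S hS Sb hSb ε hε z hzeq fxx fxy fyy rfl rfl rfl
  rw [eventually_nhdsWithin_iff, Metric.eventually_nhds_iff] at h
  obtain ⟨δ, hδ, h⟩ := h
  refine ⟨C, δ ^ 2, by positivity, fun t ht => ?_⟩
  have ht0 : 0 < t := ht.1
  have hr : 0 < √t := Real.sqrt_pos.2 ht0
  have hrt : √t ^ 2 = t := Real.sq_sqrt ht0.le
  have hrd : √t < δ := (Real.sqrt_lt' hδ).2 ht.2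
  have h1 := h (y := √t) (by rwa [Real.dist_eq, sub_zero, abs_of_pos hr]) hr ()
  have e4 : √t ^ 4 = t ^ 2 := by rw [show √t ^ 4 = (√t ^ 2) ^ 2 by ring, hrt]
  beta_reduce at h1
  rw [hrt, e4] at h1
  simp only [w1, one_pow, mul_one] at h1
  change |z t / t - ((fxx + fyy) + t * (4 * (3 * (fxxxx / 24) + fxxyy / 4 + 3 * (fyyyy / 24))
    - (fxx ^ 3 + 3 * fxx * fxy ^ 2 + 3 * fyy * fxy ^ 2 + fyy ^ 3)))| ≤ C * t ^ 2 at h1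
  have e : z t - (t * (fxx + fyy)
        + t ^ 2 * ((1 / 2) * (fxxxx + 2 * fxxyy + fyyyy)
          - (fxx ^ 3 + 3 * fxx * fxy ^ 2 + 3 * fyy * fxy ^ 2 + fyy ^ 3)))
      = t * (z t / t - ((fxx + fyy) + t * (4 * (3 * (fxxxx / 24) + fxxyy / 4 + 3 * (fyyyy / 24))
    - (fxx ^ 3 + 3 * fxx * fxy ^ 2 + 3 * fyy * fxy ^ 2 + fyy ^ 3)))) := by
    field_simp
    ring
  rw [e, abs_mul, abs_of_pos ht0]
  calc _ ≤ t * (C * t ^ 2) := by gcongr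
    _ = _ := by ring
end

section
/- Let d ≥ 1, τ > 0, M ≥ 1, and let γ_{m,i} (1 ≤ m ≤ M, 0 ≤ i ≤ m−1) be real numbers with Σ_{i=0}^{m−1} γ_{m,i} = 1 for each m, such that the quantities γ̃ and S̃ defined by the stated downward recursion satisfy S̃_{m,m} > 0 for m = 1, …, M. Let Σ̄_0 ⊆ ℝ^d be a measurable set of finite Lebesgue measure and define recursively, for m = 1, …, M, Σ̄_m = { x ∈ ℝ^d : (G_τ * Σ_{i=0}^{m−1} γ_{m,i} 1_{Σ̄_i})(x) ≥ 1/2 }, assuming each Σ̄_m has finite Lebesgue measure. Then E_τ(Σ̄_M) ≤ E_τ(Σ̄_0); i.e., the M-stage threshold dynamics scheme is unconditionally energy stable in any dimension. -/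
open MeasureTheory

/-- The Gaussian kernel on `ℝ^d` at time `t`. -/
noncomputable def gaussKer (d : ℕ) (t : ℝ) (x : EuclideanSpace ℝ (Fin d)) : ℝ :=
  (4 * Real.pi * t) ^ (-(d : ℝ) / 2) * Real.exp (-‖x‖ ^ 2 / (4 * t))

/-- Convolution of the Gaussian kernel on `ℝ^d` with a function. -/
noncomputable def gaussConv (d : ℕ) (t : ℝ) (u : EuclideanSpace ℝ (Fin d) → ℝ)
    (x : EuclideanSpace ℝ (Fin d)) : ℝ :=
  ∫ y : EuclideanSpace ℝ (Fin d), gaussKer d t (x - y) * u y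

/-- The threshold-dynamics energy `E_τ(Σ) = ∫ (1 − 1_Σ)(G_τ * 1_Σ)`. -/
noncomputable def tdEnergy (d : ℕ) (t : ℝ) (S : Set (EuclideanSpace ℝ (Fin d))) : ℝ :=
  ∫ x : EuclideanSpace ℝ (Fin d),
    (1 - Set.indicator S 1 x) * gaussConv d t (Set.indicator S 1) x

/-- The downward recursion defining the stability coefficients `γ̃_{m,i}` and the
partial sums `S̃_{j,m}` from the weights `γ` of an `M`-stage scheme. -/
def tildeRec (M : ℕ) (γ γt St : ℕ → ℕ → ℝ) : Prop :=
  (∀ i < M, γt M i = γ M i) ∧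
  (∀ m, 1 ≤ m → m < M → ∀ i < m,
    γt m i = γ m i - ∑ j ∈ Finset.Icc (m + 1) M, γt j i * St j m / St j j) ∧
  (∀ j m : ℕ, St j m = ∑ i ∈ Finset.range m, γt j i)

/-- Abstract telescoping argument. -/
theorem td_abstract {V : Type*} [AddCommGroup V] [Module ℝ V] (B : LinearMap.BilinForm ℝ V)
    (hsym : ∀ x y, B x y = B y x) (hnn : ∀ x, 0 ≤ B x x)
    (M : ℕ) (γ : ℕ → ℕ → ℝ)
    (hγ : ∀ m, 1 ≤ m → m ≤ M → ∑ i ∈ Finset.range m, γ m i = 1)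
    (γt St : ℕ → ℕ → ℝ) (htilde : tildeRec M γ γt St)
    (hpos : ∀ m, 1 ≤ m → m ≤ M → 0 < St m m)
    (u : ℕ → V) (L : ℕ → ℝ)
    (hmin : ∀ m, m + 1 ≤ M →
      L (m + 1) - 2 * B (u (m + 1)) (∑ i ∈ Finset.range (m + 1), γ (m + 1) i • u i)
        ≤ L m - 2 * B (u m) (∑ i ∈ Finset.range (m + 1), γ (m + 1) i • u i)) :
    L M - B (u M) (u M) ≤ L 0 - B (u 0) (u 0) := by
  obtain ⟨h1, h2, h3⟩ := htilde
  set P : ℕ → ℕ → V := fun j m => ∑ i ∈ Finset.range m, γt j i • u i with hP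
  set Q : ℕ → ℕ → ℕ → V := fun j m k => P j m - St j m • u k with hQ
  set D : ℕ → ℕ → ℕ → ℝ := fun j m k => B (Q j m k) (Q j m k) / St j j with hD
  have hrec : ∀ m, 1 ≤ m → m ≤ M → ∀ i < m,
      γ m i = ∑ j ∈ Finset.Icc m M, (St j m / St j j) * γt j i := by
    intro m hm hmM i hi
    have hsplit : Finset.Icc m M = insert m (Finset.Icc (m + 1) M) := by
      ext x; simp only [Finset.mem_Icc, Finset.mem_insert]; omega
    rw [hsplit, Finset.sum_insert (by simp), div_self (hpos m hm hmM).ne', one_mul]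
    rcases hmM.lt_or_eq with h | h
    · rw [h2 m hm h i hi]
      have : ∑ j ∈ Finset.Icc (m + 1) M, γt j i * St j m / St j j
          = ∑ j ∈ Finset.Icc (m + 1) M, (St j m / St j j) * γt j i :=
        Finset.sum_congr rfl fun j _ => by ring
      rw [this]; ring
    · subst h
      rw [h1 i hi]; simp
  have hw : ∀ m, 1 ≤ m → m ≤ M → ∑ i ∈ Finset.range m, γ m i • u i
      = ∑ j ∈ Finset.Icc m M, (St j m / St j j) • P j m := by
    intro m hm hmM
    simp only [hP, Finset.smul_sum, smul_smul]
    rw [Finset.sum_comm]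
    refine Finset.sum_congr rfl fun i hi => ?_
    rw [hrec m hm hmM i (Finset.mem_range.1 hi), Finset.sum_smul]
  have hone : ∀ m, 1 ≤ m → m ≤ M → ∑ j ∈ Finset.Icc m M, (St j m / St j j) * St j m = 1 := by
    intro m hm hmM
    rw [← hγ m hm hmM]
    calc _ = ∑ j ∈ Finset.Icc m M, ∑ i ∈ Finset.range m, (St j m / St j j) * γt j i := by
          refine Finset.sum_congr rfl fun j _ => ?_
          rw [← Finset.mul_sum, ← h3]
      _ = _ := by
          rw [Finset.sum_comm]
          refine Finset.sum_congr rfl fun i hi => ?_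
          rw [hrec m hm hmM i (Finset.mem_range.1 hi)]
  have hshift : ∀ j m, Q j (m + 1) m = Q j m m := by
    intro j m
    simp only [hQ, hP, h3, Finset.sum_range_succ, add_smul]
    abel
  have hdiff : ∀ m, 1 ≤ m → m ≤ M → ∀ k l,
      ∑ j ∈ Finset.Icc m M, D j m k - ∑ j ∈ Finset.Icc m M, D j m l
        = - 2 * (B (u k) (∑ i ∈ Finset.range m, γ m i • u i)
            - B (u l) (∑ i ∈ Finset.range m, γ m i • u i)) + (B (u k) (u k) - B (u l) (u l)) := by
    intro m hm hmM k l
    rw [hw m hm hmM, ← one_mul (B (u k) (u k) - B (u l) (u l)), ← hone m hm hmM]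
    simp only [map_sum, map_smul, Finset.sum_mul, ← Finset.sum_sub_distrib, Finset.mul_sum,
      ← Finset.sum_add_distrib]
    refine Finset.sum_congr rfl fun j _ => ?_
    simp only [hD, hQ, map_sub, map_smul, LinearMap.sub_apply, LinearMap.smul_apply, smul_eq_mul]
    rw [hsym (P j m) (u k), hsym (P j m) (u l)]
    ring
  have key : ∀ m, m ≤ M → L m - B (u m) (u m) + ∑ j ∈ Finset.Icc (m + 1) M, D j m m
      ≤ L 0 - B (u 0) (u 0) := by
    intro m
    induction m with
    | zero =>
      intro _
      have : ∀ j, D j 0 0 = 0 := by intro j; simp [hD, hQ, hP, h3]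
      simp [this]
    | succ m ih =>
      intro hm
      have ih := ih (by omega)
      have e1 := hdiff (m + 1) (by omega) hm (m + 1) m
      have e2 := hmin m hm
      have e3 : ∑ j ∈ Finset.Icc (m + 1) M, D j (m + 1) m = ∑ j ∈ Finset.Icc (m + 1) M, D j m m :=
        Finset.sum_congr rfl fun j _ => by simp only [hD, hshift]
      have hsplit : Finset.Icc (m + 1) M = insert (m + 1) (Finset.Icc (m + 1 + 1) M) := by
        ext x; simp only [Finset.mem_Icc, Finset.mem_insert]; omega
      have e4 : ∑ j ∈ Finset.Icc (m + 1) M, D j (m + 1) (m + 1)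
          = D (m + 1) (m + 1) (m + 1) + ∑ j ∈ Finset.Icc (m + 1 + 1) M, D j (m + 1) (m + 1) := by
        rw [hsplit, Finset.sum_insert (by simp)]
      have e5 : 0 ≤ D (m + 1) (m + 1) (m + 1) :=
        div_nonneg (hnn _) (hpos _ (by omega) hm).le
      linarith
  simpa using key M le_rfl

theorem gaussKer_nonneg (d : ℕ) {τ : ℝ} (hτ : 0 < τ) (x) : 0 ≤ gaussKer d τ x := by
  unfold gaussKer; positivity

theorem gaussKer_continuous (d : ℕ) (τ : ℝ) : Continuous (gaussKer d τ) := by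
  unfold gaussKer; fun_prop

theorem gaussKer_neg (d : ℕ) (τ : ℝ) (x) : gaussKer d τ (-x) = gaussKer d τ x := by
  simp [gaussKer]

theorem gaussKer_le (d : ℕ) {τ : ℝ} (hτ : 0 < τ) (x) : 
    ‖gaussKer d τ x‖ ≤ (4 * Real.pi * τ) ^ (-(d : ℝ) / 2) := by
  rw [Real.norm_of_nonneg (gaussKer_nonneg d hτ x)]
  unfold gaussKer
  refine mul_le_of_le_one_right (by positivity) (Real.exp_le_one_iff.2 ?_)
  rw [neg_div]
  have : 0 ≤ ‖x‖ ^ 2 / (4 * τ) := by positivity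
  linarith

theorem gaussKer_eq (d : ℕ) (τ : ℝ) (x : EuclideanSpace ℝ (Fin d)) : gaussKer d τ x =
    (4 * Real.pi * τ) ^ (-(d : ℝ) / 2) * Real.exp (-(1 / (4 * τ)) * ‖x‖ ^ 2) := by
  unfold gaussKer; congr 2; ring

theorem gaussKer_integral (d : ℕ) {τ : ℝ} (hτ : 0 < τ) : ∫ x, gaussKer d τ x = 1 := by
  simp_rw [gaussKer_eq]
  rw [integral_const_mul, GaussianFourier.integral_rexp_neg_mul_sq_norm (by positivity)]
  rw [finrank_euclideanSpace_fin]
  have : Real.pi / (1 / (4 * τ)) = 4 * Real.pi * τ := by field_simp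
  rw [this, ← Real.rpow_add (by positivity), neg_div, neg_add_cancel, Real.rpow_zero]

theorem gaussKer_integrable (d : ℕ) {τ : ℝ} (hτ : 0 < τ) : Integrable (gaussKer d τ) := by
  by_contra h
  have := gaussKer_integral d hτ
  rw [integral_undef h] at this
  exact zero_ne_one this

/-- half-time Gaussian convolved with itself -/
theorem gaussKer_half (d : ℕ) {τ : ℝ} (hτ : 0 < τ) (x z : EuclideanSpace ℝ (Fin d)) :
    ∫ w, gaussKer d (τ / 2) (x - w) * gaussKer d (τ / 2) (w - z) = gaussKer d τ (x - z) := by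
  have hpt : ∀ w, gaussKer d (τ / 2) (x - w) * gaussKer d (τ / 2) (w - z)
      = gaussKer d (τ / 4) (w - (1 / 2 : ℝ) • (x + z)) * gaussKer d τ (x - z) := by
    intro w
    have hpar := parallelogram_law_with_norm ℝ (x - w) (w - z)
    have e1 : (x - w) + (w - z) = x - z := by abel
    have e2 : (x - w) - (w - z) = (-2 : ℝ) • (w - (1 / 2 : ℝ) • (x + z)) := by
      module
    rw [e1, e2, norm_smul] at hpar
    norm_num at hpar
    set A := ‖x - w‖
    set A' := ‖w - z‖
    set C := ‖x - z‖ with hC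
    have hF : ‖w - (1 / 2 : ℝ) • (x + z)‖ ^ 2 = (A ^ 2 + A' ^ 2) / 2 - C ^ 2 / 4 := by
      norm_num
      nlinarith
    unfold gaussKer
    rw [hF]
    have hc : (4 * Real.pi * (τ / 2)) ^ (-(d : ℝ) / 2) * (4 * Real.pi * (τ / 2)) ^ (-(d : ℝ) / 2)
      = (4 * Real.pi * (τ / 4)) ^ (-(d : ℝ) / 2) * (4 * Real.pi * τ) ^ (-(d : ℝ) / 2) := by
      rw [← Real.mul_rpow (by positivity) (by positivity),
        ← Real.mul_rpow (by positivity) (by positivity)]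
      congr 1; ring
    rw [mul_mul_mul_comm, hc, ← Real.exp_add, mul_mul_mul_comm _ (Real.exp _), ← Real.exp_add]
    congr 2
    field_simp
    ring
  simp_rw [hpt]
  rw [integral_mul_const, integral_sub_right_eq_self (fun w => gaussKer d (τ / 4) w),
    gaussKer_integral d (by positivity), one_mul]

theorem gc_prod (d : ℕ) {τ : ℝ} (hτ : 0 < τ) {u : EuclideanSpace ℝ (Fin d) → ℝ}
    (hu : Integrable u) :
    Integrable (fun p : EuclideanSpace ℝ (Fin d) × EuclideanSpace ℝ (Fin d) =>
      gaussKer d τ (p.1 - p.2) * u p.2) (volume.prod volume) := by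
  have := Integrable.convolution_integrand (ContinuousLinearMap.mul ℝ ℝ) hu
    (gaussKer_integrable d hτ)
  refine this.congr (ae_of_all _ fun p => ?_)
  simp [mul_comm]

theorem gc_inner (d : ℕ) {τ : ℝ} (hτ : 0 < τ) {u : EuclideanSpace ℝ (Fin d) → ℝ}
    (hu : Integrable u) (x) :
    Integrable (fun y => gaussKer d τ (x - y) * u y) := by
  refine hu.bdd_mul (c := (4 * Real.pi * τ) ^ (-(d : ℝ) / 2)) ?_ (ae_of_all _ fun y => gaussKer_le d hτ _)
  exact ((gaussKer_continuous d τ).comp (by fun_prop)).aestronglyMeasurable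

theorem gc_meas (d : ℕ) (τ : ℝ) {u : EuclideanSpace ℝ (Fin d) → ℝ}
    (hu : Measurable u) : Measurable (gaussConv d τ u) := by
  unfold gaussConv
  have : StronglyMeasurable (fun p : EuclideanSpace ℝ (Fin d) × EuclideanSpace ℝ (Fin d) =>
      gaussKer d τ (p.1 - p.2) * u p.2) := by
    apply Measurable.stronglyMeasurable
    have := (gaussKer_continuous d τ).measurable
    fun_prop
  exact this.integral_prod_right.measurable

theorem gc_bdd (d : ℕ) {τ : ℝ} (hτ : 0 < τ) {u : EuclideanSpace ℝ (Fin d) → ℝ}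
    (hu : Integrable u) (x) :
    ‖gaussConv d τ u x‖ ≤ (4 * Real.pi * τ) ^ (-(d : ℝ) / 2) * ∫ y, ‖u y‖ := by
  unfold gaussConv
  rw [← integral_const_mul]
  refine norm_integral_le_of_norm_le (hu.norm.const_mul _) (ae_of_all _ fun y => ?_)
  rw [norm_mul]
  exact mul_le_mul_of_nonneg_right (gaussKer_le d hτ _) (norm_nonneg _)

theorem gc_integrable (d : ℕ) {τ : ℝ} (hτ : 0 < τ) {u : EuclideanSpace ℝ (Fin d) → ℝ}
    (hu : Integrable u) : Integrable (gaussConv d τ u) :=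
  (gc_prod d hτ hu).integral_prod_left

theorem gc_integral (d : ℕ) {τ : ℝ} (hτ : 0 < τ) {u : EuclideanSpace ℝ (Fin d) → ℝ}
    (hu : Integrable u) : ∫ x, gaussConv d τ u x = ∫ x, u x := by
  unfold gaussConv
  rw [integral_integral_swap (gc_prod d hτ hu)]
  congr 1; ext y
  rw [integral_mul_const, integral_sub_right_eq_self (fun w => gaussKer d τ w),
    gaussKer_integral d hτ, one_mul]

theorem gc_mul_integrable (d : ℕ) {τ : ℝ} (hτ : 0 < τ) {u v : EuclideanSpace ℝ (Fin d) → ℝ}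
    (hu : Integrable u) (hv : Integrable v) (hvm : Measurable v) :
    Integrable (fun x => u x * gaussConv d τ v x) :=
  hu.mul_bdd (gc_meas d τ hvm).aestronglyMeasurable (ae_of_all _ fun x => gc_bdd d hτ hv x)

theorem gc_symm (d : ℕ) {τ : ℝ} (hτ : 0 < τ) {u v : EuclideanSpace ℝ (Fin d) → ℝ}
    (hu : Integrable u) (hv : Integrable v) (hvm : Measurable v) :
    ∫ x, u x * gaussConv d τ v x = ∫ x, v x * gaussConv d τ u x := by
  unfold gaussConv
  simp_rw [← integral_const_mul]
  have hint : Integrable (fun p : EuclideanSpace ℝ (Fin d) × EuclideanSpace ℝ (Fin d) =>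
      v p.1 * (gaussKer d τ (p.1 - p.2) * u p.2)) (volume.prod volume) := by
    have h := (hv.mul_prod hu).bdd_mul (c := (4 * Real.pi * τ) ^ (-(d : ℝ) / 2))
      (f := fun p : EuclideanSpace ℝ (Fin d) × EuclideanSpace ℝ (Fin d) => gaussKer d τ (p.1 - p.2))
      ((gaussKer_continuous d τ).comp (by fun_prop)).aestronglyMeasurable
      (ae_of_all _ fun x => gaussKer_le d hτ _)
    refine h.congr (ae_of_all _ fun p => ?_)
    ring
  rw [integral_integral_swap (f := fun x y => v x * (gaussKer d τ (x - y) * u y)) hint]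
  congr 1; ext x; congr 1; ext y
  rw [← gaussKer_neg, neg_sub]; ring

theorem gc_symm' (d : ℕ) {τ : ℝ} (hτ : 0 < τ) {u g : EuclideanSpace ℝ (Fin d) → ℝ}
    (hu : Integrable u) {c : ℝ} (hg : ∀ x, ‖g x‖ ≤ c) (hgm : Measurable g) :
    ∫ x, u x * gaussConv d τ g x = ∫ x, g x * gaussConv d τ u x := by
  unfold gaussConv
  simp_rw [← integral_const_mul]
  have hint : Integrable (fun p : EuclideanSpace ℝ (Fin d) × EuclideanSpace ℝ (Fin d) =>
      g p.1 * (gaussKer d τ (p.1 - p.2) * u p.2)) (volume.prod volume) :=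
    (gc_prod d hτ hu).bdd_mul (c := c) (hgm.comp measurable_fst).aestronglyMeasurable
      (ae_of_all _ fun x => hg _)
  rw [integral_integral_swap (f := fun x y => g x * (gaussKer d τ (x - y) * u y)) hint]
  congr 1; ext x; congr 1; ext y
  rw [← gaussKer_neg, neg_sub]; ring

theorem gc_semigroup (d : ℕ) {τ : ℝ} (hτ : 0 < τ) {u : EuclideanSpace ℝ (Fin d) → ℝ}
    (hu : Integrable u) (x) :
    gaussConv d (τ / 2) (gaussConv d (τ / 2) u) x = gaussConv d τ u x := by
  have hτ2 : 0 < τ / 2 := by positivity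
  unfold gaussConv
  simp_rw [← integral_const_mul]
  have hint : Integrable (fun p : EuclideanSpace ℝ (Fin d) × EuclideanSpace ℝ (Fin d) =>
      gaussKer d (τ / 2) (x - p.1) * (gaussKer d (τ / 2) (p.1 - p.2) * u p.2))
      (volume.prod volume) := by
    refine (gc_prod d hτ2 hu).bdd_mul (c := (4 * Real.pi * (τ / 2)) ^ (-(d : ℝ) / 2))
      ?_ (ae_of_all _ fun x => gaussKer_le d hτ2 _)
    exact ((gaussKer_continuous d (τ / 2)).comp (by fun_prop)).aestronglyMeasurable
  rw [integral_integral_swap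
    (f := fun w y => gaussKer d (τ / 2) (x - w) * (gaussKer d (τ / 2) (w - y) * u y)) hint]
  congr 1; ext y
  simp_rw [← mul_assoc]
  rw [integral_mul_const, gaussKer_half d hτ]

theorem gc_nonneg (d : ℕ) {τ : ℝ} (hτ : 0 < τ) {u : EuclideanSpace ℝ (Fin d) → ℝ}
    (hu : Integrable u) (hum : Measurable u) :
    0 ≤ ∫ x, u x * gaussConv d τ u x := by
  have hτ2 : 0 < τ / 2 := by positivity
  simp_rw [← gc_semigroup d hτ hu]
  rw [gc_symm' d hτ2 hu (gc_bdd d hτ2 hu) (gc_meas d _ hum)]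
  exact integral_nonneg fun x => mul_self_nonneg _

theorem gc_add (d : ℕ) {τ : ℝ} (hτ : 0 < τ) {u v : EuclideanSpace ℝ (Fin d) → ℝ}
    (hu : Integrable u) (hv : Integrable v) (x) :
    gaussConv d τ (u + v) x = gaussConv d τ u x + gaussConv d τ v x := by
  unfold gaussConv
  rw [← integral_add (gc_inner d hτ hu x) (gc_inner d hτ hv x)]
  congr 1; ext y; simp only [Pi.add_apply]; ring

theorem gc_smul (d : ℕ) {τ : ℝ} (c : ℝ) {u : EuclideanSpace ℝ (Fin d) → ℝ} (x) :
    gaussConv d τ (c • u) x = c * gaussConv d τ u x := by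
  unfold gaussConv
  rw [← integral_const_mul]
  congr 1; ext y; simp only [Pi.smul_apply, smul_eq_mul]; ring

/-- Measurable integrable functions. -/
def tdSpace (d : ℕ) : Submodule ℝ (EuclideanSpace ℝ (Fin d) → ℝ) where
  carrier := {u | Measurable u ∧ Integrable u volume}
  add_mem' ha hb := ⟨ha.1.add hb.1, ha.2.add hb.2⟩
  zero_mem' := ⟨measurable_const, integrable_zero _ _ _⟩
  smul_mem' c _ hu := ⟨hu.1.const_smul c, hu.2.smul c⟩

/-- The Gaussian bilinear form. -/
noncomputable def tdForm (d : ℕ) {τ : ℝ} (hτ : 0 < τ) : LinearMap.BilinForm ℝ (tdSpace d) :=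
  LinearMap.mk₂ ℝ (fun u v => ∫ x, u.1 x * gaussConv d τ v.1 x)
    (by
      intro a b v
      rw [← integral_add (gc_mul_integrable d hτ a.2.2 v.2.2 v.2.1)
        (gc_mul_integrable d hτ b.2.2 v.2.2 v.2.1)]
      congr 1; ext x; simp only [Submodule.coe_add, Pi.add_apply]; ring)
    (by
      intro c a v
      rw [smul_eq_mul, ← integral_const_mul]
      congr 1; ext x; simp only [Submodule.coe_smul, Pi.smul_apply, smul_eq_mul]; ring)
    (by
      intro u a b
      rw [← integral_add (gc_mul_integrable d hτ u.2.2 a.2.2 a.2.1)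
        (gc_mul_integrable d hτ u.2.2 b.2.2 b.2.1)]
      congr 1; ext x; rw [Submodule.coe_add, gc_add d hτ a.2.2 b.2.2]; ring)
    (by
      intro c u a
      rw [smul_eq_mul, ← integral_const_mul]
      congr 1; ext x; rw [Submodule.coe_smul, gc_smul]; ring)

theorem tdForm_apply (d : ℕ) {τ : ℝ} (hτ : 0 < τ) (u v : tdSpace d) :
    tdForm d hτ u v = ∫ x, u.1 x * gaussConv d τ v.1 x := rfl

theorem ind_mem {d : ℕ} {S : Set (EuclideanSpace ℝ (Fin d))} (hS : MeasurableSet S)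
    (hf : volume S < ⊤) : (S.indicator 1 : EuclideanSpace ℝ (Fin d) → ℝ) ∈ tdSpace d := by
  refine ⟨measurable_one.indicator hS, ?_⟩
  exact (integrable_indicator_iff hS).2 (integrableOn_const hf.ne)

theorem tdEnergy_eq (d : ℕ) {τ : ℝ} (hτ : 0 < τ) {S : Set (EuclideanSpace ℝ (Fin d))}
    (h : (S.indicator 1 : EuclideanSpace ℝ (Fin d) → ℝ) ∈ tdSpace d) :
    tdEnergy d τ S = (∫ x, (S.indicator 1 : EuclideanSpace ℝ (Fin d) → ℝ) x)
      - tdForm d hτ ⟨_, h⟩ ⟨_, h⟩ := by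
  rw [tdForm_apply, ← gc_integral d hτ h.2, ← integral_sub (gc_integrable d hτ h.2)
    (gc_mul_integrable d hτ h.2 h.2 h.1)]
  unfold tdEnergy
  congr 1; ext x; ring


/-- Unconditional energy stability of the `M`-stage threshold dynamics scheme in any
dimension: if the weights `γ` have unit row sums and the stability conditions
`S̃_{m,m} > 0` hold for `m = 1,…,M`, then `E_τ(Σ̄_M) ≤ E_τ(Σ̄_0)`. -/
theorem multistage_td_unconditionally_energy_stable
    (d : ℕ) (hd : 1 ≤ d) (τ : ℝ) (hτ : 0 < τ) (M : ℕ) (hM : 1 ≤ M)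
    (γ : ℕ → ℕ → ℝ)
    (hγ : ∀ m, 1 ≤ m → m ≤ M → ∑ i ∈ Finset.range m, γ m i = 1)
    (γt St : ℕ → ℕ → ℝ) (htilde : tildeRec M γ γt St)
    (hpos : ∀ m, 1 ≤ m → m ≤ M → 0 < St m m)
    (Sb : ℕ → Set (EuclideanSpace ℝ (Fin d)))
    (hS0meas : MeasurableSet (Sb 0)) (hS0fin : volume (Sb 0) < ⊤)
    (hSb : ∀ m, 1 ≤ m → m ≤ M →
      Sb m = {x : EuclideanSpace ℝ (Fin d) |
        1 / 2 ≤ gaussConv d τ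
          (fun y => ∑ i ∈ Finset.range m, γ m i * Set.indicator (Sb i) 1 y) x})
    (hSbfin : ∀ m, 1 ≤ m → m ≤ M → volume (Sb m) < ⊤) :
    tdEnergy d τ (Sb M) ≤ tdEnergy d τ (Sb 0) := by
  classical
  have hmem : ∀ m, m ≤ M → ((Sb m).indicator 1 : EuclideanSpace ℝ (Fin d) → ℝ) ∈ tdSpace d := by
    intro m
    induction m using Nat.strong_induction_on with
    | _ m ih =>
      intro hm
      rcases Nat.eq_zero_or_pos m with rfl | h
      · exact ind_mem hS0meas hS0fin
      · refine ind_mem ?_ (hSbfin m h hm)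
        rw [hSb m h hm]
        refine measurableSet_le measurable_const (gc_meas d τ ?_)
        refine Finset.measurable_sum _ fun i hi => ?_
        have hi := Finset.mem_range.1 hi
        exact (ih i hi (by omega)).1.const_mul _
  let u : ℕ → tdSpace d := fun m => if h : m ≤ M then ⟨_, hmem m h⟩ else 0
  have hu : ∀ m (h : m ≤ M), u m = ⟨_, hmem m h⟩ := fun m h => dif_pos h
  rw [tdEnergy_eq d hτ (hmem M le_rfl), tdEnergy_eq d hτ (hmem 0 (by omega)),
    ← hu M le_rfl, ← hu 0 (by omega)]
  refine td_abstract (tdForm d hτ) (fun x y => gc_symm d hτ x.2.2 y.2.2 y.2.1)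
    (fun x => gc_nonneg d hτ x.2.2 x.2.1) M γ hγ γt St htilde hpos u
    (fun m => ∫ x, ((Sb m).indicator 1 : EuclideanSpace ℝ (Fin d) → ℝ) x) ?_
  intro m hm
  set w := ∑ i ∈ Finset.range (m + 1), γ (m + 1) i • u i with hw
  have hwf : w.1 = fun y => ∑ i ∈ Finset.range (m + 1), γ (m + 1) i * Set.indicator (Sb i) 1 y := by
    ext y
    rw [hw, Submodule.coe_sum, Finset.sum_apply]
    refine Finset.sum_congr rfl fun i hi => ?_
    have hi := Finset.mem_range.1 hi
    rw [hu i (by omega)]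
    rfl
  have hS := hSb (m + 1) (by omega) hm
  rw [← hwf] at hS
  have h1 := hmem (m + 1) hm
  have h0 := hmem m (by omega)
  rw [hu _ hm, hu m (by omega), tdForm_apply, tdForm_apply, ← integral_const_mul,
    ← integral_const_mul,
    ← integral_sub h1.2 ((gc_mul_integrable d hτ h1.2 w.2.2 w.2.1).const_mul 2),
    ← integral_sub h0.2 ((gc_mul_integrable d hτ h0.2 w.2.2 w.2.1).const_mul 2)]
  refine integral_mono (h1.2.sub ((gc_mul_integrable d hτ h1.2 w.2.2 w.2.1).const_mul 2))
    (h0.2.sub ((gc_mul_integrable d hτ h0.2 w.2.2 w.2.1).const_mul 2)) fun x => ?_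
  have hx : x ∈ Sb (m + 1) ↔ 1 / 2 ≤ gaussConv d τ w.1 x := by
    conv_lhs => rw [hS]
    rfl
  by_cases ha : x ∈ Sb (m + 1)
  · have := hx.1 ha
    by_cases hb : x ∈ Sb m <;> simp [ha, hb]
    linarith
  · have := mt hx.2 ha
    by_cases hb : x ∈ Sb m <;> simp [ha, hb]
    linarith
end
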